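/- arXiv:2312.07811 — 3 statements merged into one kernel-verified Lean document; each statement's English description precedes it below -/
import Mathlib

section
/- Let Γ be a finitely generated nilpotent group with a finite symmetric generating set S and word metric d_S. For every finite list of elements y_1, …, y_m ∈ Γ and every ε > 0, there exist ξ > 0 and n̄ ∈ ℕ such that for all n > n̄ and all integers n_1, …, n_m with 0 ≤ n_j ≤ ⌊ξ n⌋, one has (1/n) · d_S( y_m^{n−n_m} y_{m−1}^{n−n_{m−1}} ⋯ y_1^{n−n_1} , y_m^{n} y_{m−1}^{n} ⋯ y_1^{n} ) < ε. -/
open Filter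

/-- The word length of `x` with respect to a generating set `S`. -/
noncomputable def wordLength {Γ : Type*} [Group Γ] (S : Set Γ) (x : Γ) : ℕ :=
  sInf {n | ∃ l : List Γ, (∀ s ∈ l, s ∈ S) ∧ l.prod = x ∧ l.length = n}

/-- The word metric `d_S(x,y) = ‖y x⁻¹‖_S`. -/
noncomputable def wordDist {Γ : Type*} [Group Γ] (S : Set Γ) (x y : Γ) : ℕ :=
  wordLength S (y * x⁻¹)


namespace SPP

open scoped commutatorElement

/-- Iterated brackets of weight `j` in the elements of `S`. -/
inductive T {Γ : Type*} [Group Γ] (S : Set Γ) : ℕ → Γ → Prop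
  | base (s : Γ) (hs : s ∈ S) : T S 1 s
  | comm (i j : ℕ) (a b : Γ) (ha : T S i a) (hb : T S j b) : T S (i + j) ⁅a, b⁆

/-- `Om δ L v x`: `x` is a word in the letters of `L`, of total weight at most `v`, where a letter
of weight `j` counts `δ ^ j`. -/
inductive Om {Γ : Type*} [Group Γ] (δ : ℝ) (L : Set (ℕ × Γ)) : ℝ → Γ → Prop
  | one (v : ℝ) (hv : 0 ≤ v) : Om δ L v 1
  | cons (j : ℕ) (t : Γ) (v : ℝ) (x : Γ) (ht : (j, t) ∈ L) (hx : Om δ L v x) :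
      Om δ L (δ ^ j + v) (t * x)

/-- Letters of weight at least `l`. -/
def Lv {Γ : Type*} [Group Γ] (S : Set Γ) (l : ℕ) : Set (ℕ × Γ) := {p | T S p.1 p.2 ∧ l ≤ p.1}

/-- Upper sets of letters. -/
def Upper {Γ : Type*} [Group Γ] (S : Set Γ) (L : Set (ℕ × Γ)) : Prop :=
  (∀ p ∈ L, T S p.1 p.2) ∧ ∀ p ∈ L, ∀ q : ℕ × Γ, T S q.1 q.2 → p.1 < q.1 → q ∈ L

section
variable {Γ : Type*} [Group Γ] {S : Set Γ}

lemma T.pos {j : ℕ} {x : Γ} (h : T S j x) : 0 < j := by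
  induction h with
  | base => exact one_pos
  | comm => omega

lemma T.inv (hS : ∀ s ∈ S, s⁻¹ ∈ S) {j : ℕ} {x : Γ} (h : T S j x) : T S j x⁻¹ := by
  cases h with
  | base s hs => exact T.base _ (hS _ hs)
  | comm i j a b ha hb =>
    rw [commutatorElement_inv, add_comm]
    exact T.comm _ _ _ _ hb ha

lemma T.finite (hS : S.Finite) (j : ℕ) : {x | T S j x}.Finite := by
  induction j using Nat.strong_induction_on with
  | _ j ih =>
    have h2 : (⋃ p ∈ (Finset.range j ×ˢ Finset.range j : Finset (ℕ × ℕ)),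
        Set.image2 (fun a b : Γ => ⁅a, b⁆) {x | T S p.1 x} {x | T S p.2 x}).Finite := by
      apply Set.Finite.biUnion (Finset.finite_toSet _)
      intro p hp
      simp only [Finset.coe_product, Set.mem_prod, Finset.coe_range, Set.mem_Iio] at hp
      exact Set.Finite.image2 _ (ih _ hp.1) (ih _ hp.2)
    refine (hS.union h2).subset ?_
    intro x hx
    cases hx with
    | base s hs => exact Or.inl hs
    | comm i j a b ha hb =>
      right
      have := ha.pos
      have := hb.pos
      simp only [Set.mem_iUnion]
      refine ⟨(i, j), ?_, a, ha, b, hb, rfl⟩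
      simp
      omega

lemma T.lcs (k : ℕ) : ∀ {j : ℕ} {x : Γ}, T S j x → 2 ^ k ≤ j →
    x ∈ (⊤ : Subgroup Γ).lowerCentralSeries k := by
  induction k with
  | zero => intro j x _ _; simp
  | succ k ih =>
    intro j x h hj
    have h1 : 1 ≤ 2 ^ k := Nat.one_le_two_pow
    cases h with
    | base s hs => rw [pow_succ] at hj; omega
    | comm i j a b ha hb =>
      rw [pow_succ] at hj
      rw [Subgroup.lowerCentralSeries_succ]
      rcases (by omega : 2 ^ k ≤ i ∨ 2 ^ k ≤ j) with h | h
      · exact Subgroup.subset_closure ⟨a, ih ha h, b, Subgroup.mem_top _, rfl⟩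
      · rw [← commutatorElement_inv]
        exact Subgroup.inv_mem _ (Subgroup.subset_closure ⟨b, ih hb h, a, Subgroup.mem_top _, rfl⟩)

lemma T.triv [Group.IsNilpotent Γ] : ∃ D : ℕ, ∀ (j : ℕ) (x : Γ), T S j x → D ≤ j → x = 1 := by
  obtain ⟨n, hn⟩ := Subgroup.nilpotent_iff_lowerCentralSeries.1 (inferInstance : Group.IsNilpotent Γ)
  refine ⟨2 ^ n, fun j x h hj => ?_⟩
  have := T.lcs n h hj
  rw [hn] at this
  simpa using this

lemma upper_Lv (l : ℕ) : Upper S (Lv S l) :=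
  ⟨fun p hp => hp.1, fun p hp q hq h => ⟨hq, hp.2.trans h.le⟩⟩

variable {δ : ℝ} {L : Set (ℕ × Γ)}

lemma Om.nonneg (hδ : 0 < δ) {v : ℝ} {x : Γ} (h : Om δ L v x) : 0 ≤ v := by
  induction h with
  | one v hv => exact hv
  | cons => positivity

lemma Om.mono {v w : ℝ} {x : Γ} (h : Om δ L v x) (hvw : v ≤ w) : Om δ L w x := by
  induction h generalizing w with
  | one v hv => exact Om.one _ (hv.trans hvw)
  | cons j t v x ht hx ih =>
    have := Om.cons j t (w - δ ^ j) x ht (ih (by linarith))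
    simpa using this

lemma Om.sub {L' : Set (ℕ × Γ)} (hL : L ⊆ L') {v : ℝ} {x : Γ} (h : Om δ L v x) :
    Om δ L' v x := by
  induction h with
  | one v hv => exact Om.one _ hv
  | cons j t v x ht hx ih => exact Om.cons j t v x (hL ht) ih

lemma Om.level {l l' : ℕ} (hl : l' ≤ l) {v : ℝ} {x : Γ} (h : Om δ (Lv S l) v x) :
    Om δ (Lv S l') v x := h.sub (L' := Lv S l') (fun _ hp => ⟨hp.1, hl.trans hp.2⟩)

lemma Om.mul {v w : ℝ} {x y : Γ} (hδ : 0 < δ) (h : Om δ L v x) (h' : Om δ L w y) :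
    Om δ L (v + w) (x * y) := by
  induction h with
  | one v hv => simpa using h'.mono (by linarith)
  | cons j t v x ht hx ih =>
    rw [mul_assoc, add_assoc]
    exact Om.cons _ _ _ _ ht ih

lemma Om.letter {j : ℕ} {t : Γ} (ht : (j, t) ∈ L) : Om δ L (δ ^ j) t := by
  simpa using Om.cons (δ := δ) j t 0 1 ht (Om.one 0 le_rfl)

lemma Om.letLv {j l : ℕ} {t : Γ} (ht : T S j t) (hl : l ≤ j) : Om δ (Lv S l) (δ ^ j) t :=
  Om.letter (j := j) (L := Lv S l) ⟨ht, hl⟩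

lemma Om.pow {v : ℝ} {x : Γ} (hδ : 0 < δ) (h : Om δ L v x) (k : ℕ) :
    Om δ L (k * v) (x ^ k) := by
  induction k with
  | zero => simpa using Om.one (δ := δ) (L := L) 0 le_rfl
  | succ k ih =>
    rw [pow_succ]
    have := ih.mul hδ h
    push_cast
    rwa [add_mul, one_mul]

lemma Om.inv (hS : ∀ s ∈ S, s⁻¹ ∈ S) {l : ℕ} (hδ : 0 < δ) {v : ℝ} {x : Γ}
    (h : Om δ (Lv S l) v x) : Om δ (Lv S l) v x⁻¹ := by
  induction h with
  | one v hv => simpa using Om.one (δ := δ) (L := Lv S l) v hv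
  | cons j t v x ht hx ih =>
    rw [mul_inv_rev, add_comm]
    exact ih.mul hδ (Om.letter (j := j) ⟨ht.1.inv hS, ht.2⟩)

lemma Om.conj_letter (hδ : 0 < δ) (hL : Upper S L) {i : ℕ} {t : Γ} (ht : T S i t)
    {v : ℝ} {x : Γ} (h : Om δ L v x) : Om δ L (Real.exp (δ ^ i) * v) (t * x * t⁻¹) := by
  induction h with
  | one v hv =>
    simpa using Om.one (δ := δ) (L := L) _ (by positivity : 0 ≤ Real.exp (δ ^ i) * v)
  | cons j u v x hu hx ih =>
    have e : t * (u * x) * t⁻¹ = ⁅t, u⁆ * (u * (t * x * t⁻¹)) := by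
      rw [commutatorElement_def]; group
    rw [e]
    have hc : (i + j, ⁅t, u⁆) ∈ L := by
      refine hL.2 _ hu _ (T.comm _ _ _ _ ht (hL.1 _ hu)) ?_
      have := ht.pos
      simp only
      omega
    refine (Om.cons _ _ _ _ hc (Om.cons _ _ _ _ hu ih)).mono ?_
    have h1 := Real.add_one_le_exp (δ ^ i)
    have h2 : 0 < δ ^ j := by positivity
    rw [pow_add]
    nlinarith

lemma Om.conj (hδ : 0 < δ) (hL : Upper S L) {l : ℕ} {w : ℝ} {g : Γ} (hg : Om δ (Lv S l) w g)
    {v : ℝ} {x : Γ} (h : Om δ L v x) : Om δ L (Real.exp w * v) (g * x * g⁻¹) := by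
  induction hg with
  | one w hw =>
    have := h.nonneg hδ
    have h1 := Real.one_le_exp hw
    have := h.mono (w := Real.exp w * v) (by nlinarith)
    simpa using this
  | cons j t w g ht hg ih =>
    have := Om.conj_letter hδ hL ht.1 ih
    rw [← mul_assoc, ← Real.exp_add] at this
    simpa [mul_assoc] using this

lemma comm_mul_left (a b c : Γ) : ⁅a * b, c⁆ = a * ⁅b, c⁆ * a⁻¹ * ⁅a, c⁆ := by
  simp only [commutatorElement_def]; group

lemma comm_mul_right (a b c : Γ) : ⁅a, b * c⁆ = ⁅a, b⁆ * (b * ⁅a, c⁆ * b⁻¹) := by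
  simp only [commutatorElement_def]; group

lemma Om.comm_letter (hδ : 0 < δ) {i j : ℕ} {u : Γ} (hu : T S j u) {w : ℝ} {g : Γ}
    (hg : Om δ (Lv S i) w g) :
    Om δ (Lv S (i + j)) (δ ^ j * (Real.exp w - 1)) ⁅g, u⁆ := by
  induction hg with
  | one w hw =>
    have h1 := Real.one_le_exp hw
    have : 0 ≤ δ ^ j * (Real.exp w - 1) := mul_nonneg (by positivity) (by linarith)
    simpa using Om.one (δ := δ) (L := Lv S (i + j)) _ this
  | cons k t w g ht hg ih =>
    rw [comm_mul_left]
    have h1 := Om.conj_letter hδ (upper_Lv _) ht.1 ih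
    have h2 : Om δ (Lv S (i + j)) (δ ^ (k + j)) ⁅t, u⁆ :=
      Om.letter ⟨T.comm _ _ _ _ ht.1 hu, by have := ht.2; simp only at this ⊢; omega⟩
    refine (h1.mul hδ h2).mono ?_
    have h1 := Real.add_one_le_exp (δ ^ k)
    have h2 : 0 < δ ^ j := by positivity
    rw [pow_add, Real.exp_add]
    nlinarith

lemma Om.comm (hδ : 0 < δ) {i j : ℕ} {v w : ℝ} {g h : Γ}
    (hg : Om δ (Lv S i) w g) (hh : Om δ (Lv S j) v h) :
    Om δ (Lv S (i + j)) ((Real.exp w - 1) * (Real.exp v - 1)) ⁅g, h⁆ := by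
  have hw : 0 ≤ Real.exp w - 1 := by linarith [Real.one_le_exp (hg.nonneg hδ)]
  induction hh with
  | one v hv =>
    have h1 := Real.one_le_exp hv
    have : 0 ≤ (Real.exp w - 1) * (Real.exp v - 1) := mul_nonneg hw (by linarith)
    simpa using Om.one (δ := δ) (L := Lv S (i + j)) _ this
  | cons k t v h ht hh ih =>
    rw [comm_mul_right]
    have h1 := Om.conj_letter hδ (upper_Lv _) ht.1 ih
    have h2 : Om δ (Lv S (i + j)) _ ⁅g, t⁆ :=
      (Om.comm_letter hδ ht.1 hg).level (by have := ht.2; simp only at this; omega)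
    refine (h2.mul hδ h1).mono ?_
    have h1 := Real.add_one_le_exp (δ ^ k)
    rw [Real.exp_add]
    nlinarith

lemma exp_sub_one_le (x : ℝ) : Real.exp x - 1 ≤ x * Real.exp x := by
  have h := Real.add_one_le_exp (-x)
  have h1 := Real.exp_pos x
  have : Real.exp x * Real.exp (-x) = 1 := by rw [← Real.exp_add]; simp
  nlinarith

/-- `[a^p, b]` is `t^p` up to higher weight. -/
lemma step1 (hδ : 0 < δ) (hδ1 : δ ≤ 1) {i j : ℕ} {a b : Γ} (ha : T S i a) (hb : T S j b)
    {K : ℝ} (p : ℕ) (hp : p * δ ^ i ≤ K) :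
    ∃ y, ⁅a ^ p, b⁆ = y * ⁅a, b⁆ ^ p ∧
      Om δ (Lv S (i + j + 1)) (p * (δ ^ (i + j) * Real.exp K) * Real.exp (p * δ ^ (i + j))) y := by
  induction p with
  | zero => exact ⟨1, by simp, by simpa using Om.one (δ := δ) (L := Lv S (i + j + 1)) 0 le_rfl⟩
  | succ p ih =>
    have hpi : 0 < δ ^ i := by positivity
    have hpij : 0 < δ ^ (i + j) := by positivity
    push_cast at hp
    obtain ⟨y, hy, hO⟩ := ih (by nlinarith)
    have ht := T.comm _ _ _ _ ha hb
    have hap : Om δ (Lv S i) _ (a ^ p) := (Om.letLv ha le_rfl).pow hδ p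
    have h0 := Om.comm_letter hδ ht hap
    have h0' : Om δ (Lv S (i + j + 1)) (δ ^ (i + j) * Real.exp K) ⁅a ^ p, ⁅a, b⁆⁆ := by
      refine (h0.level (by have := ha.pos; omega)).mono ?_
      have : Real.exp (p * δ ^ i) ≤ Real.exp K := Real.exp_le_exp.2 (by nlinarith)
      nlinarith
    have h1 := Om.conj_letter hδ (upper_Lv _) ht hO
    refine ⟨⁅a ^ p, ⁅a, b⁆⁆ * (⁅a, b⁆ * y * ⁅a, b⁆⁻¹), ?_, (h0'.mul hδ h1).mono ?_⟩
    · rw [pow_succ a, comm_mul_left, hy, pow_succ' ⁅a, b⁆]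
      rw [commutatorElement_def (a ^ p) ⁅a, b⁆]
      simp only [mul_assoc, inv_mul_cancel_left]
    · push_cast
      have e : Real.exp ((p + 1) * δ ^ (i + j)) =
        Real.exp (δ ^ (i + j)) * Real.exp (p * δ ^ (i + j)) := by
        rw [← Real.exp_add]; congr 1; ring
      have h2 : 1 ≤ Real.exp ((p + 1) * δ ^ (i + j)) := Real.one_le_exp (by positivity)
      have h3 : 0 < δ ^ (i + j) * Real.exp K := by positivity
      have : Real.exp (δ ^ (i + j)) * (p * (δ ^ (i + j) * Real.exp K) * Real.exp (p * δ ^ (i + j)))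
        = p * (δ ^ (i + j) * Real.exp K) * Real.exp ((p + 1) * δ ^ (i + j)) := by
        rw [e]; ring
      rw [this]
      nlinarith

lemma step2 {i j : ℕ} {a b : Γ} (ha : T S i a) (hb : T S j b) {K : ℝ} (hK : 0 ≤ K) :
    ∃ C : ℝ, ∀ δ : ℝ, 0 < δ → δ ≤ 1 → ∀ p q : ℕ, p * δ ^ i ≤ K → q * δ ^ j ≤ K →
    ∃ y, ⁅a ^ p, b ^ q⁆ = y * ⁅a, b⁆ ^ (p * q) ∧ Om δ (Lv S (i + j + 1)) C y := by
  set E := Real.exp K with hE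
  set C1 := E * E + E * (E * Real.exp (K * E)) with hC1
  have hE0 : 0 < E := Real.exp_pos _
  have hC10 : 0 < C1 := by positivity
  refine ⟨K * K * C1 * Real.exp (K * K), fun δ hδ hδ1 p q hp hq => ?_⟩
  have hpi : 0 < δ ^ i := by positivity
  have hpj : 0 < δ ^ j := by positivity
  have hpj1 : δ ^ j ≤ 1 := pow_le_one₀ hδ.le hδ1
  have hu0 : (0:ℝ) ≤ p * δ ^ (i + j) := by positivity
  have huK : p * δ ^ (i + j) ≤ K := by
    rw [pow_add, ← mul_assoc]
    have : (0:ℝ) ≤ p * δ ^ i := by positivity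
    nlinarith
  have ht := T.comm _ _ _ _ ha hb
  obtain ⟨y, hy, hO⟩ := step1 hδ hδ1 ha hb p hp
  have hap : Om δ (Lv S i) _ (a ^ p) := (Om.letLv ha le_rfl).pow hδ p
  have hX : Om δ (Lv S (i + j)) (p * δ ^ (i + j) * E) ⁅a ^ p, b⁆ := by
    refine (Om.comm_letter hδ hb hap).mono ?_
    have h1 := exp_sub_one_le (p * δ ^ i)
    have h2 : Real.exp (p * δ ^ i) ≤ E := Real.exp_le_exp.2 hp
    have h3 : (0:ℝ) ≤ p * δ ^ i := by positivity
    calc δ ^ j * (Real.exp (p * δ ^ i) - 1) ≤ δ ^ j * (p * δ ^ i * E) := by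
          gcongr; nlinarith
      _ = _ := by rw [pow_add]; ring
  have hO' : Om δ (Lv S (i + j + 1)) (p * δ ^ (i + j) * (E * E)) y := by
    refine hO.mono ?_
    have : Real.exp (p * δ ^ (i + j)) ≤ E := Real.exp_le_exp.2 huK
    calc p * (δ ^ (i + j) * E) * Real.exp (p * δ ^ (i + j)) ≤ p * (δ ^ (i + j) * E) * E := by
          gcongr
      _ = _ := by ring
  have key : ∀ r : ℕ, r ≤ q → ∃ z, ⁅a ^ p, b ^ r⁆ = z * ⁅a, b⁆ ^ (p * r) ∧
      Om δ (Lv S (i + j + 1)) (r * (p * δ ^ (i + j) * C1 * Real.exp (K * K))) z := by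
    intro r
    induction r with
    | zero =>
      intro _
      exact ⟨1, by simp, by simpa using Om.one (δ := δ) (L := Lv S (i + j + 1)) 0 le_rfl⟩
    | succ r ih =>
      intro hr
      obtain ⟨z, hz, hOz⟩ := ih (by omega)
      have hrq : (r : ℝ) * δ ^ j ≤ K := by
        have : (r : ℝ) ≤ q := by exact_mod_cast (by omega : r ≤ q)
        nlinarith
      have hbr : Om δ (Lv S j) _ (b ^ r) := (Om.letLv hb le_rfl).pow hδ r
      have h1 := (Om.comm hδ hbr hX).level (l' := i + j + 1) (by have := hb.pos; omega)
      have h1' : Om δ (Lv S (i + j + 1)) (p * δ ^ (i + j) * (E * (E * Real.exp (K * E))))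
          ⁅b ^ r, ⁅a ^ p, b⁆⁆ := by
        refine h1.mono ?_
        have g1 : Real.exp (r * δ ^ j) - 1 ≤ E := by
          have : Real.exp (r * δ ^ j) ≤ E := Real.exp_le_exp.2 hrq
          linarith
        have g0 : 0 ≤ Real.exp (p * δ ^ (i + j) * E) - 1 := by
          have : 1 ≤ Real.exp (p * δ ^ (i + j) * E) := Real.one_le_exp (by positivity)
          linarith
        have g2 := exp_sub_one_le (p * δ ^ (i + j) * E)
        have g3 : Real.exp (p * δ ^ (i + j) * E) ≤ Real.exp (K * E) :=
          Real.exp_le_exp.2 (by gcongr)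
        have g4 : Real.exp (p * δ ^ (i + j) * E) - 1 ≤ p * δ ^ (i + j) * E * Real.exp (K * E) :=
          g2.trans (by gcongr)
        calc (Real.exp (r * δ ^ j) - 1) * (Real.exp (p * δ ^ (i + j) * E) - 1)
            ≤ E * (p * δ ^ (i + j) * E * Real.exp (K * E)) := by
              apply mul_le_mul g1 g4 g0 hE0.le
          _ = _ := by ring
      have h2 := h1'.mul hδ hO'
      have htp : Om δ (Lv S (i + j)) _ (⁅a, b⁆ ^ (p * r)) :=
        (Om.letLv ht le_rfl).pow hδ (p * r)
      have h3 := Om.conj hδ (upper_Lv _) htp h2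
      refine ⟨z * (⁅a, b⁆ ^ (p * r) * (⁅b ^ r, ⁅a ^ p, b⁆⁆ * y) * (⁅a, b⁆ ^ (p * r))⁻¹), ?_,
        (hOz.mul hδ h3).mono ?_⟩
      · rw [pow_succ b, comm_mul_right, hz, mul_add, mul_one, pow_add ⁅a, b⁆]
        have : b ^ r * ⁅a ^ p, b⁆ * (b ^ r)⁻¹ = ⁅b ^ r, ⁅a ^ p, b⁆⁆ * ⁅a ^ p, b⁆ := by
          rw [commutatorElement_def (b ^ r), inv_mul_cancel_right]
        rw [this]
        nth_rewrite 2 [hy]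
        simp only [mul_assoc, inv_mul_cancel_left]
      · have g : Real.exp (((p * r : ℕ) : ℝ) * δ ^ (i + j)) ≤ Real.exp (K * K) := by
          apply Real.exp_le_exp.2
          push_cast
          calc (p : ℝ) * r * δ ^ (i + j) = (p * δ ^ i) * (r * δ ^ j) := by rw [pow_add]; ring
            _ ≤ K * K := by gcongr
        have e : (p * δ ^ (i + j) * (E * (E * Real.exp (K * E))) + p * δ ^ (i + j) * (E * E))
          = p * δ ^ (i + j) * C1 := by rw [hC1]; ring
        rw [e]
        push_cast at g ⊢
        have g5 : Real.exp ((p : ℝ) * r * δ ^ (i + j)) * (p * δ ^ (i + j) * C1)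
          ≤ Real.exp (K * K) * (p * δ ^ (i + j) * C1) := by gcongr
        linarith
  obtain ⟨z, hz, hOz⟩ := key q le_rfl
  refine ⟨z, hz, hOz.mono ?_⟩
  calc q * (p * δ ^ (i + j) * C1 * Real.exp (K * K))
      = (p * δ ^ i) * (q * δ ^ j) * C1 * Real.exp (K * K) := by rw [pow_add]; ring
    _ ≤ _ := by gcongr

/-! Word length. -/

lemma exists_word (hSsym : ∀ s ∈ S, s⁻¹ ∈ S) (hSgen : Subgroup.closure S = ⊤) (x : Γ) :
    ∃ l : List Γ, (∀ s ∈ l, s ∈ S) ∧ l.prod = x ∧ l.length = wordLength S x := by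
  have hne : {n | ∃ l : List Γ, (∀ s ∈ l, s ∈ S) ∧ l.prod = x ∧ l.length = n}.Nonempty := by
    have hx : x ∈ Subgroup.closure S := by rw [hSgen]; trivial
    rw [← Subgroup.mem_toSubmonoid, Subgroup.closure_toSubmonoid] at hx
    obtain ⟨l, hl, hp⟩ := Submonoid.exists_list_of_mem_closure hx
    refine ⟨l.length, l, fun s hs => ?_, hp, rfl⟩
    rcases hl s hs with h | h
    · exact h
    · simpa using hSsym _ h
  exact Nat.sInf_mem hne

lemma wl_le {l : List Γ} (hl : ∀ s ∈ l, s ∈ S) : wordLength S l.prod ≤ l.length :=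
  Nat.sInf_le ⟨l, hl, rfl, rfl⟩

lemma wl_mul (hSsym : ∀ s ∈ S, s⁻¹ ∈ S) (hSgen : Subgroup.closure S = ⊤) (x y : Γ) :
    wordLength S (x * y) ≤ wordLength S x + wordLength S y := by
  obtain ⟨l, hl, hp, hn⟩ := exists_word hSsym hSgen x
  obtain ⟨l', hl', hp', hn'⟩ := exists_word hSsym hSgen y
  rw [← hn, ← hn', ← hp, ← hp', ← List.prod_append, ← List.length_append]
  apply wl_le
  intro s hs
  rcases List.mem_append.1 hs with h | h
  exacts [hl s h, hl' s h]

lemma wl_inv (hSsym : ∀ s ∈ S, s⁻¹ ∈ S) (hSgen : Subgroup.closure S = ⊤) (x : Γ) :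
    wordLength S x⁻¹ ≤ wordLength S x := by
  obtain ⟨l, hl, hp, hn⟩ := exists_word hSsym hSgen x
  rw [← hn, ← hp, List.prod_inv_reverse]
  refine (wl_le ?_).trans (by simp)
  intro s hs
  simp only [List.mem_reverse, List.mem_map] at hs
  obtain ⟨a, ha, rfl⟩ := hs
  exact hSsym _ (hl a ha)

lemma wl_one : wordLength S (1 : Γ) = 0 := by
  have := wl_le (S := S) (l := []) (by simp)
  simpa using this

lemma wl_pow {s : Γ} (hs : s ∈ S) (k : ℕ) : wordLength S (s ^ k) ≤ k := by
  have := wl_le (S := S) (l := List.replicate k s) (by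
    intro t ht; rw [List.eq_of_mem_replicate ht]; exact hs)
  simpa using this

lemma Om_wl (hSsym : ∀ s ∈ S, s⁻¹ ∈ S) (hSgen : Subgroup.closure S = ⊤) (hδ : 0 < δ) (x : Γ) :
    Om δ (Lv S 1) (wordLength S x * δ) x := by
  obtain ⟨l, hl, hp, hn⟩ := exists_word hSsym hSgen x
  rw [← hn]
  clear hn
  induction l generalizing x with
  | nil => simpa [← hp] using Om.one (δ := δ) (L := Lv S 1) 0 le_rfl
  | cons s l ih =>
    have := ih l.prod (fun t ht => hl t (by simp [ht])) rfl
    have h2 := Om.cons 1 s _ _ (⟨T.base s (hl s (by simp)), le_rfl⟩ : (1, s) ∈ Lv S 1) this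
    rw [← hp, List.prod_cons]
    refine h2.mono ?_
    simp only [List.length_cons]
    push_cast
    linarith

/-! Families. -/

variable {ι : Type*}

/-- Families of uniformly bounded weight. -/
def B (S : Set Γ) (d : ι → ℝ) (L : Set (ℕ × Γ)) (f : ι → Γ) : Prop :=
  ∃ K : ℝ, ∀ x, Om (d x) L K (f x)

/-- Families of length `O(1/d)`. -/
def Ln (S : Set Γ) (d : ι → ℝ) (f : ι → Γ) : Prop :=
  ∃ K : ℝ, ∀ x, (wordLength S (f x) : ℝ) * d x ≤ K

variable {d : ι → ℝ}

lemma B.mul (hd : ∀ x, 0 < d x) {f g : ι → Γ} (hf : B S d L f) (hg : B S d L g) :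
    B S d L (f * g) := by
  obtain ⟨K, hK⟩ := hf
  obtain ⟨K', hK'⟩ := hg
  exact ⟨K + K', fun x => (hK x).mul (hd x) (hK' x)⟩

lemma B.inv (hS : ∀ s ∈ S, s⁻¹ ∈ S) (hd : ∀ x, 0 < d x) {l : ℕ} {f : ι → Γ}
    (hf : B S d (Lv S l) f) : B S d (Lv S l) f⁻¹ := by
  obtain ⟨K, hK⟩ := hf
  exact ⟨K, fun x => (hK x).inv hS (hd x)⟩

lemma B.conj (hd : ∀ x, 0 < d x) (hL : Upper S L) {l : ℕ} {f g : ι → Γ}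
    (hg : B S d (Lv S l) g) (hf : B S d L f) : B S d L (g * f * g⁻¹) := by
  obtain ⟨K, hK⟩ := hf
  obtain ⟨K', hK'⟩ := hg
  exact ⟨_, fun x => Om.conj (hd x) hL (hK' x) (hK x)⟩

lemma B.comm (hd : ∀ x, 0 < d x) {i j : ℕ} {f g : ι → Γ}
    (hg : B S d (Lv S i) g) (hf : B S d (Lv S j) f) : B S d (Lv S (i + j)) ⁅g, f⁆ := by
  obtain ⟨K, hK⟩ := hf
  obtain ⟨K', hK'⟩ := hg
  exact ⟨_, fun x => Om.comm (hd x) (hK' x) (hK x)⟩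

lemma B.level {l l' : ℕ} (hl : l' ≤ l) {f : ι → Γ} (hf : B S d (Lv S l) f) :
    B S d (Lv S l') f := by
  obtain ⟨K, hK⟩ := hf
  exact ⟨K, fun x => (hK x).level hl⟩

lemma B.pow (hd : ∀ x, 0 < d x) {i : ℕ} {t : Γ} (ht : T S i t) {k : ι → ℕ} {K : ℝ}
    (hk : ∀ x, k x * d x ^ i ≤ K) : B S d (Lv S i) (fun x => t ^ k x) :=
  ⟨K, fun x => ((Om.letLv ht le_rfl).pow (hd x) (k x)).mono (hk x)⟩

lemma Ln.mul (hSsym : ∀ s ∈ S, s⁻¹ ∈ S) (hSgen : Subgroup.closure S = ⊤) (hd : ∀ x, 0 < d x)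
    {f g : ι → Γ} (hf : Ln S d f) (hg : Ln S d g) : Ln S d (f * g) := by
  obtain ⟨K, hK⟩ := hf
  obtain ⟨K', hK'⟩ := hg
  refine ⟨K + K', fun x => ?_⟩
  have h : (wordLength S (f x * g x) : ℝ) ≤ wordLength S (f x) + wordLength S (g x) := by
    exact_mod_cast wl_mul hSsym hSgen (f x) (g x)
  have := hK x
  have := hK' x
  have := hd x
  simp only [Pi.mul_apply]
  nlinarith

lemma Ln.inv (hSsym : ∀ s ∈ S, s⁻¹ ∈ S) (hSgen : Subgroup.closure S = ⊤) (hd : ∀ x, 0 < d x)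
    {f : ι → Γ} (hf : Ln S d f) : Ln S d f⁻¹ := by
  obtain ⟨K, hK⟩ := hf
  refine ⟨K, fun x => ?_⟩
  have h : (wordLength S (f x)⁻¹ : ℝ) ≤ wordLength S (f x) := by
    exact_mod_cast wl_inv hSsym hSgen (f x)
  have := hK x
  have := hd x
  simp only [Pi.inv_apply]
  nlinarith

lemma Ln.toB (hSsym : ∀ s ∈ S, s⁻¹ ∈ S) (hSgen : Subgroup.closure S = ⊤) (hd : ∀ x, 0 < d x)
    {f : ι → Γ} (hf : Ln S d f) : B S d (Lv S 1) f := by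
  obtain ⟨K, hK⟩ := hf
  exact ⟨K, fun x => (Om_wl hSsym hSgen (hd x) (f x)).mono (hK x)⟩

/-- Approximate distortion. -/
lemma distortion (hSsym : ∀ s ∈ S, s⁻¹ ∈ S) (hSgen : Subgroup.closure S = ⊤)
    (hd : ∀ x, 0 < d x) (hd1 : ∀ x, d x ≤ 1) {i : ℕ} {t : Γ} (ht : T S i t) :
    ∀ (k : ι → ℕ) (K : ℝ), (∀ x, k x * d x ^ i ≤ K) →
      ∃ z r : ι → Γ, (fun x => t ^ k x) = z * r ∧ Ln S d z ∧ B S d (Lv S (i + 1)) r := by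
  induction ht with
  | base s hs =>
    intro k K hk
    refine ⟨fun x => s ^ k x, 1, by simp, ⟨K, fun x => ?_⟩, ⟨0, fun x => Om.one _ le_rfl⟩⟩
    have h : (wordLength S (s ^ k x) : ℝ) ≤ k x := by exact_mod_cast wl_pow hs (k x)
    have h1 := hk x
    have := hd x
    simp only [pow_one] at h1
    nlinarith
  | comm i j a b ha hb iha ihb =>
    have main : ∀ (p q : ι → ℕ) (K : ℝ), (∀ x, p x * d x ^ i ≤ K) → (∀ x, q x * d x ^ j ≤ K) →
        ∃ z r : ι → Γ, (fun x => ⁅a, b⁆ ^ (p x * q x)) = z * r ∧ Ln S d z ∧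
          B S d (Lv S (i + j + 1)) r := by
      intro p q K hp hq
      obtain ⟨z1, r1, e1, hz1, hr1⟩ := iha p K hp
      obtain ⟨z2, r2, e2, hz2, hr2⟩ := ihb q K hq
      obtain ⟨C, hC⟩ := step2 ha hb (abs_nonneg K)
      choose y hy hO using fun x => hC (d x) (hd x) (hd1 x) (p x) (q x)
        ((hp x).trans (le_abs_self K)) ((hq x).trans (le_abs_self K))
      have hyB : B S d (Lv S (i + j + 1)) y := ⟨C, hO⟩
      have hA : B S d (Lv S i) (fun x => a ^ p x) := B.pow hd ha hp
      have hB : B S d (Lv S j) (fun x => b ^ q x) := B.pow hd hb hq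
      have hz1' : B S d (Lv S i) z1 := by
        have : z1 = (fun x => a ^ p x) * r1⁻¹ := by rw [e1]; simp
        rw [this]
        exact hA.mul hd ((hr1.level (by omega)).inv hSsym hd)
      have hz : Ln S d ⁅z1, z2⁆ := by
        rw [commutatorElement_def]
        exact ((hz1.mul hSsym hSgen hd hz2).mul hSsym hSgen hd (hz1.inv hSsym hSgen hd)).mul
          hSsym hSgen hd (hz2.inv hSsym hSgen hd)
      have c1 : B S d (Lv S (i + j + 1)) (z1 * ⁅r1, fun x => b ^ q x⁆ * z1⁻¹) :=
        B.conj hd (upper_Lv _) hz1' ((B.comm hd hr1 hB).level (by omega))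
      have c2 : B S d (Lv S (i + j + 1)) (z2 * ⁅z1, r2⁆ * z2⁻¹) :=
        B.conj hd (upper_Lv _) (hz2.toB hSsym hSgen hd) ((B.comm hd hz1' hr2).level (by omega))
      refine ⟨⁅z1, z2⁆, (⁅z1, z2⁆⁻¹ * (y⁻¹ * (z1 * ⁅r1, fun x => b ^ q x⁆ * z1⁻¹)) * ⁅z1, z2⁆⁻¹⁻¹) *
        (z2 * ⁅z1, r2⁆ * z2⁻¹), ?_, hz, ?_⟩
      · have h1 : (fun x => ⁅a, b⁆ ^ (p x * q x)) = y⁻¹ * ⁅fun x => a ^ p x, fun x => b ^ q x⁆ := by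
          funext x
          have := hy x
          simp only [Pi.mul_apply, Pi.inv_apply]
          change _ = (y x)⁻¹ * ⁅a ^ p x, b ^ q x⁆
          rw [this]; simp
        rw [h1, e1, e2, comm_mul_left z1 r1, comm_mul_right z1 z2 r2]
        group
      · exact (B.conj hd (upper_Lv _) ((hz.inv hSsym hSgen hd).toB hSsym hSgen hd)
          ((hyB.inv hSsym hd).mul hd c1)).mul hd c2
    intro k K hk
    set P : ι → ℕ := fun x => ⌈(d x ^ i)⁻¹⌉₊ with hP
    have hPlow : ∀ x, 1 ≤ P x * d x ^ i := by
      intro x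
      have h0 : 0 < d x ^ i := pow_pos (hd x) i
      have := Nat.le_ceil ((d x ^ i)⁻¹)
      calc (1:ℝ) = (d x ^ i)⁻¹ * d x ^ i := by field_simp
        _ ≤ _ := by gcongr
    have hPup : ∀ x, P x * d x ^ i ≤ 2 := by
      intro x
      have h0 : 0 < d x ^ i := pow_pos (hd x) i
      have h1 : d x ^ i ≤ 1 := pow_le_one₀ (hd x).le (hd1 x)
      have := (Nat.ceil_lt_add_one (inv_nonneg.2 h0.le)).le
      calc (P x : ℝ) * d x ^ i ≤ ((d x ^ i)⁻¹ + 1) * d x ^ i := by gcongr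
        _ = 1 + d x ^ i := by field_simp
        _ ≤ 2 := by linarith
    have hPpos : ∀ x, 0 < P x := by
      intro x
      rcases Nat.eq_zero_or_pos (P x) with h | h
      · have := hPlow x
        rw [h] at this; norm_num at this
      · exact h
    obtain ⟨z1, r1, e1, hz1, hr1⟩ := main P (fun x => k x / P x) (max 2 K)
      (fun x => (hPup x).trans (le_max_left _ _)) (fun x => by
        refine le_trans ?_ (le_max_right 2 K)
        refine le_trans ?_ (hk x)
        have hj0 : 0 < d x ^ j := pow_pos (hd x) j
        have hi0 : 0 < d x ^ i := pow_pos (hd x) i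
        have h2 : ((k x / P x : ℕ) : ℝ) * P x ≤ k x := by
          exact_mod_cast Nat.div_mul_le_self (k x) (P x)
        have h3 := hPlow x
        have h4 : (0:ℝ) ≤ ((k x / P x : ℕ) : ℝ) := by positivity
        calc ((k x / P x : ℕ) : ℝ) * d x ^ j
            ≤ ((k x / P x : ℕ) : ℝ) * d x ^ j * (P x * d x ^ i) :=
              le_mul_of_one_le_right (by positivity) h3
          _ = (((k x / P x : ℕ) : ℝ) * P x) * (d x ^ i * d x ^ j) := by ring
          _ ≤ k x * (d x ^ i * d x ^ j) := by gcongr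
          _ = _ := by rw [pow_add])
    obtain ⟨z2, r2, e2, hz2, hr2⟩ := main (fun x => k x % P x) (fun _ => 1) 2
      (fun x => by
        refine le_trans ?_ (hPup x)
        have h0 : 0 < d x ^ i := pow_pos (hd x) i
        have : ((k x % P x : ℕ) : ℝ) ≤ P x := by exact_mod_cast (Nat.mod_lt _ (hPpos x)).le
        gcongr)
      (fun x => by
        have h1 : d x ^ j ≤ 1 := pow_le_one₀ (hd x).le (hd1 x)
        push_cast
        linarith)
    refine ⟨z1 * z2, (z2⁻¹ * r1 * z2⁻¹⁻¹) * r2, ?_, hz1.mul hSsym hSgen hd hz2, ?_⟩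
    · have : (fun x => ⁅a, b⁆ ^ k x) = (fun x => ⁅a, b⁆ ^ (P x * (k x / P x))) *
          (fun x => ⁅a, b⁆ ^ (k x % P x * 1)) := by
        funext x
        simp only [Pi.mul_apply]
        rw [← pow_add, mul_one, Nat.div_add_mod]
      rw [this, e1, e2]
      group
    · exact (B.conj hd (upper_Lv _) ((hz2.inv hSsym hSgen hd).toB hSsym hSgen hd) hr1).mul hd hr2

/-- Pulling out a letter. -/
lemma pull (hSsym : ∀ s ∈ S, s⁻¹ ∈ S) (hδ : 0 < δ) {i : ℕ} {t : Γ} (ht : T S i t)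
    (hL' : Upper S (L \ {(i, t)})) {v : ℝ} {x : Γ} (h : Om δ L v x) :
    ∃ (k : ℕ) (y : Γ), x = t ^ k * y ∧ k * δ ^ i ≤ v ∧
      Om δ (L \ {(i, t)}) (v * Real.exp v) y := by
  induction h with
  | one v hv => exact ⟨0, 1, by simp, by simpa using hv, Om.one _ (by positivity)⟩
  | cons j u v x hu hx ih =>
    obtain ⟨k, y, rfl, hk, hO⟩ := ih
    have hv := hx.nonneg hδ
    have hj : 0 < δ ^ j := pow_pos hδ j
    have hexp : Real.exp v ≤ Real.exp (δ ^ j + v) := Real.exp_le_exp.2 (by linarith)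
    by_cases hc : (j, u) = (i, t)
    · obtain ⟨rfl, rfl⟩ := Prod.mk.inj hc
      refine ⟨k + 1, y, by rw [pow_succ']; group, by push_cast; linarith, hO.mono ?_⟩
      exact mul_le_mul (by linarith) hexp (Real.exp_pos _).le (by linarith)
    · have h1 : Om δ (L \ {(i, t)}) (δ ^ j) u := Om.letter ⟨hu, hc⟩
      have h2 : Om δ (Lv S i) _ (t⁻¹ ^ k) :=
        (Om.letLv (ht.inv hSsym) le_rfl).pow hδ k
      have h3 := Om.conj hδ hL' h2 h1
      refine ⟨k, _, ?_, by linarith, (h3.mul hδ hO).mono ?_⟩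
      · simp [mul_assoc]
      · have h4 : Real.exp (k * δ ^ i) ≤ Real.exp (δ ^ j + v) :=
          Real.exp_le_exp.2 (by linarith)
        nlinarith

lemma claim (hSfin : S.Finite) (hSsym : ∀ s ∈ S, s⁻¹ ∈ S) (hSgen : Subgroup.closure S = ⊤)
    (hd : ∀ x, 0 < d x) (hd1 : ∀ x, d x ≤ 1) {D : ℕ}
    (hD : ∀ (j : ℕ) (x : Γ), T S j x → D ≤ j → x = 1) (n : ℕ) :
    ∀ L : Set (ℕ × Γ), Upper S L → {p | p ∈ L ∧ p.1 < D}.ncard = n →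
      ∀ f : ι → Γ, B S d L f → Ln S d f := by
  induction n using Nat.strong_induction_on with
  | _ n ih =>
    intro L hL hn f hf
    have hfin : {p | p ∈ L ∧ p.1 < D}.Finite := by
      have : (⋃ j ∈ Set.Iio D, (fun x : Γ => (j, x)) '' {x | T S j x}).Finite :=
        (Set.finite_Iio D).biUnion fun j _ => (T.finite hSfin j).image _
      refine this.subset ?_
      rintro ⟨j, x⟩ ⟨hp, hj⟩
      simp only [Set.mem_iUnion]
      exact ⟨j, hj, x, hL.1 _ hp, rfl⟩
    rcases Set.eq_empty_or_nonempty {p | p ∈ L ∧ p.1 < D} with h0 | hne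
    · obtain ⟨K, hK⟩ := hf
      refine ⟨0, fun x => ?_⟩
      have key : ∀ v y, Om (d x) L v y → y = 1 := by
        intro v y h
        induction h with
        | one => rfl
        | cons j t v y ht hy ihy =>
          rw [ihy, mul_one]
          apply hD j t (hL.1 _ ht)
          by_contra hlt
          have : (j, t) ∈ {p | p ∈ L ∧ p.1 < D} := ⟨ht, not_le.1 hlt⟩
          rw [h0] at this
          exact this
      rw [key _ _ (hK x), wl_one]
      simp
    · obtain ⟨⟨i, t⟩, hmem, hmin⟩ := Set.exists_min_image _ (fun p : ℕ × Γ => p.1) hfin hne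
      have ht : T S i t := hL.1 _ hmem.1
      have hmin' : ∀ p ∈ L, i ≤ p.1 := by
        intro p hp
        by_cases h : p.1 < D
        · exact hmin p ⟨hp, h⟩
        · have : i < D := hmem.2
          omega
      have hL' : Upper S (L \ {(i, t)}) := by
        refine ⟨fun p hp => hL.1 p hp.1, fun p hp q hq hlt => ⟨hL.2 p hp.1 q hq hlt, ?_⟩⟩
        rintro rfl
        have := hmin' p hp.1
        simp only at hlt
        omega
      have hlt : {p | p ∈ L \ {(i, t)} ∧ p.1 < D}.ncard < n := by
        rw [← hn]
        apply Set.ncard_lt_ncard _ hfin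
        refine ⟨fun p hp => ⟨hp.1.1, hp.2⟩, fun hsub => ?_⟩
        exact (hsub hmem).1.2 rfl
      obtain ⟨K, hK⟩ := hf
      choose k y hxy hk hO using fun x => pull hSsym (hd x) ht hL' (hK x)
      obtain ⟨z, r, e, hz, hr⟩ := distortion hSsym hSgen hd hd1 ht k K hk
      have hr' : B S d (L \ {(i, t)}) r := by
        obtain ⟨K', hK'⟩ := hr
        refine ⟨K', fun x => (hK' x).sub ?_⟩
        intro q hq
        refine ⟨hL.2 _ hmem.1 q hq.1 ?_, ?_⟩
        · have := hq.2
          simp only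
          omega
        · rintro rfl
          have := hq.2
          simp only at this
          omega
      have : f = z * (r * y) := by
        rw [← mul_assoc, ← e]
        funext x
        exact hxy x
      rw [this]
      exact hz.mul hSsym hSgen hd (ih _ hlt _ hL' rfl _ (hr'.mul hd ⟨_, hO⟩))

lemma main_bound [Group.IsNilpotent Γ] (hSfin : S.Finite) (hSsym : ∀ s ∈ S, s⁻¹ ∈ S)
    (hSgen : Subgroup.closure S = ⊤) (K : ℝ) :
    ∃ C : ℝ, 0 < C ∧ ∀ (δ : ℝ) (x : Γ), 0 < δ → δ ≤ 1 → Om δ (Lv S 1) K x →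
      (wordLength S x : ℝ) * δ ≤ C := by
  obtain ⟨D, hD⟩ := T.triv (S := S)
  obtain ⟨C, hC⟩ := claim (ι := {p : ℝ × Γ // 0 < p.1 ∧ p.1 ≤ 1 ∧ Om p.1 (Lv S 1) K p.2})
    (d := fun p => p.1.1) hSfin hSsym hSgen (fun p => p.2.1) (fun p => p.2.2.1) hD _
    (Lv S 1) (upper_Lv 1) rfl (fun p => p.1.2) ⟨K, fun p => p.2.2.2⟩
  refine ⟨max C 1, by positivity, fun δ x h0 h1 h => ?_⟩
  exact (hC ⟨(δ, x), h0, h1, h⟩).trans (le_max_left _ _)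

lemma Om.rescale {D : ℕ} (hD : ∀ (j : ℕ) (x : Γ), T S j x → D ≤ j → x = 1) (hδ : 0 < δ)
    {η : ℝ} (hη : 0 < η) (hη1 : η ≤ 1) {l : ℕ} {v : ℝ} {x : Γ} (h : Om δ (Lv S l) v x) :
    Om (δ / η) (Lv S l) ((η ^ D)⁻¹ * v) x := by
  induction h with
  | one v hv => exact Om.one _ (by positivity)
  | cons j t v x ht hx ih =>
    by_cases hj : D ≤ j
    · rw [hD j t ht.1 hj, one_mul]
      refine ih.mono ?_
      have : 0 < δ ^ j := by positivity
      gcongr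
      linarith
    · refine (Om.cons j t _ _ ht ih).mono ?_
      rw [mul_add, div_pow, div_eq_inv_mul]
      have : η ^ D ≤ η ^ j := pow_le_pow_of_le_one hη.le hη1 (by omega)
      gcongr

lemma list_bound (hSsym : ∀ s ∈ S, s⁻¹ ∈ S) (hSgen : Subgroup.closure S = ⊤)
    {m : ℕ} (y : Fin m → Γ) (l : List (Fin m)) :
    ∃ C : ℝ, 0 ≤ C ∧ ∀ (n : ℕ) (ξ : ℝ) (nj : Fin m → ℕ), 0 < n → 0 < ξ → ξ ≤ 1 →
      (∀ j, (nj j : ℝ) ≤ ξ * n) →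
      Om (1 / (n : ℝ)) (Lv S 1) (ξ * C) ((l.map (fun j => y j ^ n)).prod *
        ((l.map (fun j => y j ^ (n - nj j))).prod)⁻¹) := by
  induction l with
  | nil => exact ⟨0, le_rfl, fun n ξ nj _ _ _ _ => by
      simpa using Om.one (δ := 1 / (n : ℝ)) (L := Lv S 1) 0 le_rfl⟩
  | cons j l ih =>
    obtain ⟨C, hC0, hC⟩ := ih
    obtain ⟨w, hw⟩ : ∃ w : ℝ, w = (wordLength S (y j) : ℝ) := ⟨_, rfl⟩
    have hw0 : 0 ≤ w := by rw [hw]; positivity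
    refine ⟨Real.exp w * C + w, by positivity, fun n ξ nj hn hξ hξ1 hnj => ?_⟩
    have hn0 : (0:ℝ) < n := by exact_mod_cast hn
    have hδ : (0:ℝ) < 1 / n := by positivity
    have h1 := hC n ξ nj hn hξ hξ1 hnj
    have hy := Om_wl hSsym hSgen hδ (y j)
    have h2 : Om (1 / (n : ℝ)) (Lv S 1) w (y j ^ n) := (hy.pow hδ n).mono (by
      rw [← hw]; field_simp; exact le_rfl)
    have h3 : Om (1 / (n : ℝ)) (Lv S 1) (ξ * w) (y j ^ nj j) := (hy.pow hδ (nj j)).mono (by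
      rw [← hw]
      calc (nj j : ℝ) * (w * (1 / n)) ≤ (ξ * n) * (w * (1 / n)) := by gcongr; exact hnj j
        _ = ξ * w := by field_simp)
    have h4 := (Om.conj hδ (upper_Lv 1) h2 h1).mul hδ h3
    have hle : nj j ≤ n := by
      have := hnj j
      have : (nj j : ℝ) ≤ n := by nlinarith
      exact_mod_cast this
    have e : y j ^ n = y j ^ nj j * y j ^ (n - nj j) := by
      rw [← pow_add]; congr 1; omega
    have e2 : (y j ^ n)⁻¹ * y j ^ nj j = (y j ^ (n - nj j))⁻¹ := by
      have e' : y j ^ n = y j ^ (n - nj j + nj j) := by congr 1; omega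
      have e : y j ^ n = y j ^ nj j * y j ^ (n - nj j) := by
        rw [← pow_add]; congr 1; omega
      rw [inv_mul_eq_iff_eq_mul, eq_mul_inv_iff_mul_eq, e]
    simp only [List.map_cons, List.prod_cons, mul_inv_rev]
    rw [← e2]
    convert h4 using 1
    · ring
    · simp only [mul_assoc]

end

end SPP

/-- small perturbations of the exponents of a polygonal path are negligible on
the scale `n` for the rescaled word metric, in a finitely generated nilpotent group. -/
theorem small_perturbations_polygonal {Γ : Type*} [Group Γ] [Group.IsNilpotent Γ]
    (S : Set Γ) (hSfin : S.Finite) (hSsym : ∀ s ∈ S, s⁻¹ ∈ S)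
    (hSgen : Subgroup.closure S = ⊤)
    (m : ℕ) (y : Fin m → Γ) (ε : ℝ) (hε : 0 < ε) :
    ∃ ξ : ℝ, 0 < ξ ∧ ∃ nbar : ℕ, ∀ n : ℕ, nbar < n →
      ∀ nj : Fin m → ℕ, (∀ j, nj j ≤ ⌊ξ * (n : ℝ)⌋₊) →
        (1 / (n : ℝ)) *
          (wordDist S
            (((List.finRange m).reverse.map (fun j => y j ^ (n - nj j))).prod)
            (((List.finRange m).reverse.map (fun j => y j ^ n)).prod) : ℝ) < ε := by
  obtain ⟨D, hD⟩ := SPP.T.triv (S := S)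
  obtain ⟨A, hA0, hA⟩ := SPP.list_bound hSsym hSgen y (List.finRange m).reverse
  obtain ⟨C, hC0, hC⟩ := SPP.main_bound hSfin hSsym hSgen 1
  set η : ℝ := min 1 (ε / (2 * C)) with hη
  have hη0 : 0 < η := lt_min one_pos (by positivity)
  have hη1 : η ≤ 1 := min_le_left _ _
  have hηC : C * η < ε := by
    have : η ≤ ε / (2 * C) := min_le_right _ _
    calc C * η ≤ C * (ε / (2 * C)) := by gcongr
      _ = ε / 2 := by field_simp
      _ < ε := by linarith
  have hηD : 0 < η ^ D := by positivity
  have hηD1 : η ^ D ≤ 1 := pow_le_one₀ hη0.le hη1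
  refine ⟨η ^ D / (A + 1), by positivity, ⌈1 / η⌉₊, fun n hn nj hnj => ?_⟩
  have hn' : 1 / η < n := lt_of_le_of_lt (Nat.le_ceil _) (by exact_mod_cast hn)
  have hnpos : 0 < n := by omega
  have hn0 : (0:ℝ) < n := by exact_mod_cast hnpos
  have hξ1 : η ^ D / (A + 1) ≤ 1 := by
    rw [div_le_one (by positivity)]; linarith
  have h1 := hA n (η ^ D / (A + 1)) nj hnpos (by positivity) hξ1 (fun j =>
    (Nat.cast_le.2 (hnj j)).trans (Nat.floor_le (by positivity)))
  have h2 := (SPP.Om.rescale hD (by positivity) hη0 hη1 h1).mono (w := 1) (by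
    have : (η ^ D)⁻¹ * (η ^ D / (A + 1) * A) = A / (A + 1) := by field_simp
    rw [this, div_le_one (by positivity)]
    linarith)
  have hnη : 1 < n * η := by
    rwa [div_lt_iff₀ hη0] at hn'
  have h3 := hC _ _ (by positivity) (by
    rw [div_div, div_le_one (by positivity)]; exact hnη.le) h2
  rw [wordDist]
  refine lt_of_le_of_lt ?_ hηC
  have h4 := mul_le_mul_of_nonneg_right h3 hη0.le
  refine le_trans (le_of_eq ?_) h4
  field_simp
end

section
/- Let Γ be a finitely generated group, θ an ergodic measure-preserving action of Γ on a probability space (Ω,F,P), x ∈ Γ, ξ > 0 and E ∈ F. For ω ∈ Ω and n ∈ ℕ define N^ξ_{x,n}(E,ω) := #{ n′ ∈ {0,1,…,⌈ξn⌉−1} : θ_{x^{n−n′}}(ω) ∈ E }, and set Ξ*(E,x,ξ) := { ω : liminf_{n→∞} N^ξ_{x,n}(E,ω)/(ξn) > 0 } and Ξ*_m(E,x,ξ) := { ω : for all n ≥ m, N^ξ_{x,n}(E,ω) > 0 }. Then P(Ξ*(E,x,ξ)) ≥ P(E), and for every ε ∈ (0,1) there exists m₀ such that P(Ξ*_m(E,x,ξ))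 > P(Ξ*(E,x,ξ)) − ε for all m > m₀. -/
open MeasureTheory Filter

/-- A measure-preserving (left) action of `Γ` on a probability space. -/
def IsPMPAction {Γ : Type*} [Group Γ] {Ω : Type*} [MeasurableSpace Ω]
    (θ : Γ → Ω → Ω) (P : Measure Ω) : Prop :=
  θ 1 = id ∧ (∀ x y : Γ, θ (x * y) = θ x ∘ θ y) ∧ ∀ x : Γ, MeasurePreserving (θ x) P P

/-- Ergodicity of the action `θ`. -/
def IsErgodicAction {Γ : Type*} [Group Γ] {Ω : Type*} [MeasurableSpace Ω]
    (θ : Γ → Ω → Ω) (P : Measure Ω) : Prop :=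
  ∀ E : Set Ω, MeasurableSet E → (∀ x : Γ, θ x ⁻¹' E = E) → P E = 0 ∨ P E = 1

open Topology

namespace VisitFreq

/-- Auxiliary running maximum of Birkhoff sums. -/
noncomputable def runMax {Ω : Type*} (T : Ω → Ω) (g : Ω → ℝ) : ℕ → Ω → ℝ
  | 0 => fun _ => 0
  | n + 1 => fun ω => max 0 (g ω + runMax T g n (T ω))

lemma runMax_nonneg {Ω : Type*} (T : Ω → Ω) (g : Ω → ℝ) (n : ℕ) (ω : Ω) :
    0 ≤ runMax T g n ω := by
  cases n with
  | zero => exact le_rfl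
  | succ n => exact le_max_left _ _

lemma runMax_le_succ {Ω : Type*} (T : Ω → Ω) (g : Ω → ℝ) (n : ℕ) :
    ∀ ω : Ω, runMax T g n ω ≤ runMax T g (n + 1) ω := by
  induction n with
  | zero => intro ω; exact runMax_nonneg T g 1 ω
  | succ n ih =>
    intro ω
    exact max_le_max le_rfl (add_le_add le_rfl (ih (T ω)))

lemma birkhoffSum_le_runMax {Ω : Type*} (T : Ω → Ω) (g : Ω → ℝ) (n : ℕ) :
    ∀ ω : Ω, birkhoffSum T g n ω ≤ runMax T g n ω := by
  induction n with
  | zero => intro ω; simp [runMax]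
  | succ n ih =>
    intro ω
    rw [birkhoffSum_succ']
    exact le_trans (add_le_add le_rfl (ih (T ω))) (le_max_right _ _)

lemma runMax_integrable {Ω : Type*} [MeasurableSpace Ω] {Q : Measure Ω}
    {T : Ω → Ω} (hT : MeasurePreserving T Q Q) {g : Ω → ℝ} (hg : Integrable g Q) (n : ℕ) :
    Integrable (runMax T g n) Q := by
  induction n with
  | zero => exact integrable_zero _ _ _
  | succ n ih =>
    have h1 : Integrable (fun ω => g ω + runMax T g n (T ω)) Q :=
      hg.add (hT.integrable_comp_of_integrable ih)
    exact (integrable_zero _ _ _).sup h1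

lemma runMax_measurable {Ω : Type*} [MeasurableSpace Ω]
    {T : Ω → Ω} (hT : Measurable T) {g : Ω → ℝ} (hg : Measurable g) (n : ℕ) :
    Measurable (runMax T g n) := by
  induction n with
  | zero => exact measurable_const
  | succ n ih => exact measurable_const.max (hg.add (ih.comp hT))

/-- Maximal ergodic lemma. -/
lemma maximal {Ω : Type*} [MeasurableSpace Ω] {Q : Measure Ω}
    {T : Ω → Ω} (hT : MeasurePreserving T Q Q) {g : Ω → ℝ} (hgm : Measurable g)
    (hg : Integrable g Q) (h : ∀ᵐ ω ∂Q, ∃ n, 0 < birkhoffSum T g n ω) :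
    0 ≤ ∫ ω, g ω ∂Q := by
  have hmeas : ∀ n, MeasurableSet {ω | 0 < runMax T g n ω} := fun n =>
    measurableSet_lt measurable_const (runMax_measurable hT.measurable hgm n)
  have hpos : ∀ n, 0 ≤ ∫ ω, ({ω | 0 < runMax T g n ω}.indicator g) ω ∂Q := by
    intro n
    have hi := runMax_integrable hT hg n
    have hi' : Integrable (fun ω => runMax T g n (T ω)) Q := hT.integrable_comp_of_integrable hi
    have h0 : ∫ ω, (runMax T g n ω - runMax T g n (T ω)) ∂Q = 0 := by
      rw [integral_sub hi hi']
      have : ∫ ω, runMax T g n (T ω) ∂Q = ∫ ω, runMax T g n ω ∂Q := by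
        conv_rhs => rw [← hT.map_eq]
        rw [integral_map hT.measurable.aemeasurable
          (runMax_measurable hT.measurable hgm n).aestronglyMeasurable]
      rw [this, sub_self]
    refine h0.symm.le.trans ?_
    refine integral_mono (hi.sub hi') (hg.indicator (hmeas n)) ?_
    intro ω
    show runMax T g n ω - runMax T g n (T ω) ≤ _
    by_cases hω : 0 < runMax T g n ω
    · rw [Set.indicator_of_mem (show ω ∈ {ω | 0 < runMax T g n ω} from hω)]
      cases n with
      | zero => exact absurd hω (lt_irrefl _)
      | succ n =>
        have h1 := runMax_le_succ T g n (T ω)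
        have h2 : runMax T g (n + 1) ω = max 0 (g ω + runMax T g n (T ω)) := rfl
        rcases max_choice 0 (g ω + runMax T g n (T ω)) with h3 | h3
        · rw [h2, h3] at hω
          exact absurd hω (lt_irrefl _)
        · rw [h2, h3]; linarith
    · rw [Set.indicator_of_notMem (show ω ∉ {ω | 0 < runMax T g n ω} from hω)]
      have := runMax_nonneg T g n (T ω)
      linarith
  have hlim : Tendsto (fun n => ∫ ω, ({ω | 0 < runMax T g n ω}.indicator g) ω ∂Q) atTop
      (𝓝 (∫ ω, g ω ∂Q)) := by
    refine tendsto_integral_of_dominated_convergence (fun ω => ‖g ω‖)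
      (fun n => (hg.indicator (hmeas n)).aestronglyMeasurable) hg.norm ?_ ?_
    · intro n
      exact Eventually.of_forall fun ω => norm_indicator_le_norm_self _ _
    · filter_upwards [h] with ω hω
      obtain ⟨n, hn⟩ := hω
      refine tendsto_const_nhds.congr' ?_
      filter_upwards [eventually_ge_atTop n] with k hk
      have hmono : Monotone fun n => runMax T g n ω :=
        monotone_nat_of_le_succ fun n => runMax_le_succ T g n ω
      rw [Set.indicator_of_mem]
      exact lt_of_lt_of_le hn ((birkhoffSum_le_runMax T g n ω).trans (hmono hk))
  exact ge_of_tendsto' hlim hpos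

lemma maximal_on {Ω : Type*} [MeasurableSpace Ω] {Q : Measure Ω}
    {T : Ω → Ω} (hT : MeasurePreserving T Q Q) {g : Ω → ℝ} (hgm : Measurable g)
    (hg : Integrable g Q) {C : Set Ω} (hC : MeasurableSet C) (hinv : T ⁻¹' C = C)
    (h : ∀ ω ∈ C, ∃ n, 0 < birkhoffSum T g n ω) :
    0 ≤ ∫ ω in C, g ω ∂Q := by
  have hT' : MeasurePreserving T (Q.restrict C) (Q.restrict C) := by
    have := hT.restrict_preimage hC
    rwa [hinv] at this
  refine maximal hT' hgm hg.restrict ?_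
  exact (ae_restrict_iff' hC).2 (Eventually.of_forall h)

lemma limsup_le_aux {u v : ℕ → ℝ} (hu : ∀ n, u n ∈ Set.Icc (0 : ℝ) 1)
    (hv : ∀ n, v n ∈ Set.Icc (0 : ℝ) 1) (h : Tendsto (fun n => u n - v n) atTop (𝓝 0)) :
    limsup u atTop ≤ limsup v atTop ∧ liminf v atTop ≤ liminf u atTop := by
  have bu : IsBoundedUnder (· ≤ ·) atTop u := isBoundedUnder_of ⟨1, fun n => (hu n).2⟩
  have bu' : IsBoundedUnder (· ≥ ·) atTop u := isBoundedUnder_of ⟨0, fun n => (hu n).1⟩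
  have bv : IsBoundedUnder (· ≤ ·) atTop v := isBoundedUnder_of ⟨1, fun n => (hv n).2⟩
  have bv' : IsBoundedUnder (· ≥ ·) atTop v := isBoundedUnder_of ⟨0, fun n => (hv n).1⟩
  constructor
  · refine le_of_forall_pos_le_add fun ε hε => ?_
    refine limsup_le_of_le bu'.isCoboundedUnder_le ?_
    have h1 := eventually_lt_of_limsup_lt
      (lt_add_of_pos_right (limsup v atTop) (half_pos hε)) bv
    filter_upwards [h1, h.eventually (gt_mem_nhds (half_pos hε))] with n h2 h3
    linarith
  · refine le_of_forall_pos_le_add fun ε hε => ?_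
    rw [← sub_le_iff_le_add]
    refine le_liminf_of_le bu.isCoboundedUnder_ge ?_
    have h1 := eventually_lt_of_lt_liminf
      (sub_lt_self (liminf v atTop) (half_pos hε)) bv'
    filter_upwards [h1, h.eventually (lt_mem_nhds (neg_lt_zero.2 (half_pos hε)))] with n h2 h3
    linarith

lemma avg_mem {Ω : Type*} (T : Ω → Ω) {f : Ω → ℝ} (hf : ∀ ω, f ω ∈ Set.Icc (0 : ℝ) 1)
    (n : ℕ) (ω : Ω) : birkhoffAverage ℝ T f n ω ∈ Set.Icc (0 : ℝ) 1 := by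
  have h0 : 0 ≤ birkhoffSum T f n ω := Finset.sum_nonneg fun k _ => (hf _).1
  have h1 : birkhoffSum T f n ω ≤ n := by
    have := Finset.sum_le_card_nsmul (Finset.range n) (fun k => f (T^[k] ω)) 1
      (fun k _ => (hf _).2)
    simpa [birkhoffSum] using this
  rw [birkhoffAverage, smul_eq_mul, ← div_eq_inv_mul]
  exact ⟨by positivity, div_le_one_of_le₀ h1 (by positivity)⟩

lemma avg_inv {Ω : Type*} (T : Ω → Ω) {f : Ω → ℝ} (hf : ∀ ω, f ω ∈ Set.Icc (0 : ℝ) 1) (ω : Ω) :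
    limsup (fun n => birkhoffAverage ℝ T f n (T ω)) atTop
      = limsup (fun n => birkhoffAverage ℝ T f n ω) atTop ∧
    liminf (fun n => birkhoffAverage ℝ T f n (T ω)) atTop
      = liminf (fun n => birkhoffAverage ℝ T f n ω) atTop := by
  have hb : Bornology.IsBounded (Set.range f) :=
    (Metric.isBounded_Icc (0 : ℝ) 1).subset (by rintro _ ⟨ω, rfl⟩; exact hf ω)
  have h := tendsto_birkhoffAverage_apply_sub_birkhoffAverage' ℝ hb T ω
  have h' : Tendsto (fun n => birkhoffAverage ℝ T f n ω - birkhoffAverage ℝ T f n (T ω))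
      atTop (𝓝 0) := by simpa using h.neg
  have h1 := limsup_le_aux (fun n => avg_mem T hf n (T ω)) (fun n => avg_mem T hf n ω) h
  have h2 := limsup_le_aux (fun n => avg_mem T hf n ω) (fun n => avg_mem T hf n (T ω)) h'
  exact ⟨le_antisymm h1.1 h2.1, le_antisymm h2.2 h1.2⟩

lemma sum_of_avg_gt {Ω : Type*} (T : Ω → Ω) (f : Ω → ℝ) (b : ℝ) (n : ℕ) (hn : n ≠ 0) (ω : Ω)
    (h : b < birkhoffAverage ℝ T f n ω) : 0 < birkhoffSum T (fun ω => f ω - b) n ω := by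
  have hn' : (0 : ℝ) < n := by positivity
  rw [birkhoffAverage, smul_eq_mul, ← div_eq_inv_mul, lt_div_iff₀ hn'] at h
  simp only [birkhoffSum, Finset.sum_sub_distrib, Finset.sum_const, Finset.card_range,
    nsmul_eq_mul] at h ⊢
  linarith

lemma sum_of_avg_lt {Ω : Type*} (T : Ω → Ω) (f : Ω → ℝ) (b : ℝ) (n : ℕ) (hn : n ≠ 0) (ω : Ω)
    (h : birkhoffAverage ℝ T f n ω < b) : 0 < birkhoffSum T (fun ω => b - f ω) n ω := by
  have hn' : (0 : ℝ) < n := by positivity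
  rw [birkhoffAverage, smul_eq_mul, ← div_eq_inv_mul, div_lt_iff₀ hn'] at h
  simp only [birkhoffSum, Finset.sum_sub_distrib, Finset.sum_const, Finset.card_range,
    nsmul_eq_mul] at h ⊢
  linarith


lemma avg_measurable {Ω : Type*} [MeasurableSpace Ω]
    {T : Ω → Ω} (hT : Measurable T) {f : Ω → ℝ} (hfm : Measurable f) (n : ℕ) :
    Measurable (fun ω => birkhoffAverage ℝ T f n ω) := by
  unfold birkhoffAverage birkhoffSum
  simp only [smul_eq_mul]
  refine Measurable.const_mul ?_ _
  exact Finset.measurable_sum _ fun k _ => hfm.comp (hT.iterate k)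

lemma f_integrable {Ω : Type*} [MeasurableSpace Ω] {P : Measure Ω} [IsProbabilityMeasure P]
    {f : Ω → ℝ} (hfm : Measurable f)
    (hf : ∀ ω, f ω ∈ Set.Icc (0 : ℝ) 1) : Integrable f P :=
  Integrable.of_bound hfm.aestronglyMeasurable 1 (Eventually.of_forall fun ω => by
    rw [Real.norm_of_nonneg (hf ω).1]; exact (hf ω).2)

/-- upper bound for the integral on an invariant set where the liminf is at most `a`. -/
lemma int_le {Ω : Type*} [MeasurableSpace Ω] {P : Measure Ω} [IsProbabilityMeasure P]
    {T : Ω → Ω} (hT : MeasurePreserving T P P) {f : Ω → ℝ} (hfm : Measurable f)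
    (hf : ∀ ω, f ω ∈ Set.Icc (0 : ℝ) 1) {C : Set Ω} (hC : MeasurableSet C) (hinv : T ⁻¹' C = C)
    {a : ℝ} (h : ∀ ω ∈ C, liminf (fun n => birkhoffAverage ℝ T f n ω) atTop < a) :
    ∫ ω in C, f ω ∂P ≤ a * P.real C := by
  have hi := f_integrable (P := P) hfm hf
  have h1 : 0 ≤ ∫ ω in C, (a - f ω) ∂P := by
    refine maximal_on hT (measurable_const.sub hfm) ((integrable_const a).sub hi) hC hinv ?_
    intro ω hω
    have bu : IsBoundedUnder (· ≤ ·) atTop (fun n => birkhoffAverage ℝ T f n ω) :=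
      isBoundedUnder_of ⟨1, fun n => (avg_mem T hf n ω).2⟩
    obtain ⟨n, hn, hn0⟩ := ((frequently_lt_of_liminf_lt bu.isCoboundedUnder_ge
      (h ω hω)).and_eventually (eventually_ne_atTop 0)).exists
    exact ⟨n, sum_of_avg_lt T f a n hn0 ω hn⟩
  rw [integral_sub (integrable_const a).restrict hi.restrict, setIntegral_const, smul_eq_mul] at h1
  linarith

lemma le_int {Ω : Type*} [MeasurableSpace Ω] {P : Measure Ω} [IsProbabilityMeasure P]
    {T : Ω → Ω} (hT : MeasurePreserving T P P) {f : Ω → ℝ} (hfm : Measurable f)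
    (hf : ∀ ω, f ω ∈ Set.Icc (0 : ℝ) 1) {C : Set Ω} (hC : MeasurableSet C) (hinv : T ⁻¹' C = C)
    {b : ℝ} (h : ∀ ω ∈ C, b < limsup (fun n => birkhoffAverage ℝ T f n ω) atTop) :
    b * P.real C ≤ ∫ ω in C, f ω ∂P := by
  have hi := f_integrable (P := P) hfm hf
  have h1 : 0 ≤ ∫ ω in C, (f ω - b) ∂P := by
    refine maximal_on hT (hfm.sub measurable_const) (hi.sub (integrable_const b)) hC hinv ?_
    intro ω hω
    have bu : IsBoundedUnder (· ≥ ·) atTop (fun n => birkhoffAverage ℝ T f n ω) :=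
      isBoundedUnder_of ⟨0, fun n => (avg_mem T hf n ω).1⟩
    obtain ⟨n, hn, hn0⟩ := ((frequently_lt_of_lt_limsup bu.isCoboundedUnder_le
      (h ω hω)).and_eventually (eventually_ne_atTop 0)).exists
    exact ⟨n, sum_of_avg_gt T f b n hn0 ω hn⟩
  rw [integral_sub hi.restrict (integrable_const b).restrict, setIntegral_const, smul_eq_mul] at h1
  linarith

/-- Pointwise ergodic theorem for functions with values in `[0,1]`. -/
lemma pointwise {Ω : Type*} [MeasurableSpace Ω] {P : Measure Ω} [IsProbabilityMeasure P]
    {T : Ω → Ω} (hT : MeasurePreserving T P P) {f : Ω → ℝ} (hfm : Measurable f)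
    (hf : ∀ ω, f ω ∈ Set.Icc (0 : ℝ) 1) :
    ∀ᵐ ω ∂P, Tendsto (fun n => birkhoffAverage ℝ T f n ω) atTop
      (𝓝 (limsup (fun n => birkhoffAverage ℝ T f n ω) atTop)) := by
  have hms : Measurable fun ω => limsup (fun n => birkhoffAverage ℝ T f n ω) atTop :=
    Measurable.limsup (avg_measurable hT.measurable hfm)
  have hmi : Measurable fun ω => liminf (fun n => birkhoffAverage ℝ T f n ω) atTop :=
    Measurable.liminf (avg_measurable hT.measurable hfm)
  have key : ∀ a b : ℚ, a < b → ∀ᵐ ω ∂P,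
      ¬ (liminf (fun n => birkhoffAverage ℝ T f n ω) atTop < a ∧
        (b : ℝ) < limsup (fun n => birkhoffAverage ℝ T f n ω) atTop) := by
    intro a b hab
    set C : Set Ω := {ω | liminf (fun n => birkhoffAverage ℝ T f n ω) atTop < a ∧
        (b : ℝ) < limsup (fun n => birkhoffAverage ℝ T f n ω) atTop} with hCdef
    have hC : MeasurableSet C :=
      (measurableSet_lt hmi measurable_const).inter (measurableSet_lt measurable_const hms)
    have hinv : T ⁻¹' C = C := by
      ext ω
      simp only [hCdef, Set.mem_preimage, Set.mem_ofPred_eq, (avg_inv T hf ω).1,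
        (avg_inv T hf ω).2]
    have h1 := int_le hT hfm hf hC hinv (a := a) fun ω hω => hω.1
    have h2 := le_int hT hfm hf hC hinv (b := b) fun ω hω => hω.2
    have hab' : (a : ℝ) < b := by exact_mod_cast hab
    have h3 : 0 ≤ P.real C := measureReal_nonneg
    have h4 : P.real C = 0 := by nlinarith
    have h5 : P C = 0 := (measureReal_eq_zero_iff).1 h4
    exact measure_eq_zero_iff_ae_notMem.1 h5
  have key' : ∀ᵐ ω ∂P, ∀ a b : ℚ, a < b →
      ¬ (liminf (fun n => birkhoffAverage ℝ T f n ω) atTop < a ∧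
        (b : ℝ) < limsup (fun n => birkhoffAverage ℝ T f n ω) atTop) := by
    simp only [ae_all_iff]
    exact key
  filter_upwards [key'] with ω hω
  refine tendsto_of_le_liminf_of_limsup_le ?_ le_rfl
    (isBoundedUnder_of ⟨1, fun n => (avg_mem T hf n ω).2⟩)
    (isBoundedUnder_of ⟨0, fun n => (avg_mem T hf n ω).1⟩)
  by_contra! hlt
  obtain ⟨a, ha1, ha2⟩ := exists_rat_btwn hlt
  obtain ⟨b, hb1, hb2⟩ := exists_rat_btwn ha2
  exact hω a b (by exact_mod_cast hb1) ⟨ha1, hb2⟩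

lemma pos_on {Ω : Type*} [MeasurableSpace Ω] {P : Measure Ω} [IsProbabilityMeasure P]
    {T : Ω → Ω} (hT : MeasurePreserving T P P) {E : Set Ω} (hE : MeasurableSet E) :
    ∀ᵐ ω ∂P, ω ∈ E → ∃ l : ℝ, 0 < l ∧
      Tendsto (fun n => birkhoffAverage ℝ T (E.indicator 1) n ω) atTop (𝓝 l) := by
  set f : Ω → ℝ := E.indicator 1 with hfdef
  have hfm : Measurable f := measurable_one.indicator hE
  have hf : ∀ ω, f ω ∈ Set.Icc (0 : ℝ) 1 := by
    intro ω
    by_cases h : ω ∈ E <;> simp [hfdef, h]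
  have hms : Measurable fun ω => limsup (fun n => birkhoffAverage ℝ T f n ω) atTop :=
    Measurable.limsup (avg_measurable hT.measurable hfm)
  have hpt := pointwise hT hfm hf
  set C : Set Ω := {ω | limsup (fun n => birkhoffAverage ℝ T f n ω) atTop ≤ 0} with hCdef
  have hC : MeasurableSet C := measurableSet_le hms measurable_const
  have hinv : T ⁻¹' C = C := by
    ext ω
    simp only [hCdef, Set.mem_preimage, Set.mem_ofPred_eq, (avg_inv T hf ω).1]
  have h1 : ∀ a : ℝ, 0 < a → P.real (C ∩ E) ≤ a := by
    intro a ha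
    have h2 := int_le hT hfm hf hC hinv (a := a) fun ω hω =>
      lt_of_le_of_lt ((liminf_le_limsup
        (isBoundedUnder_of ⟨1, fun n => (avg_mem T hf n ω).2⟩)
        (isBoundedUnder_of ⟨0, fun n => (avg_mem T hf n ω).1⟩)).trans hω) ha
    have h3 : ∫ ω in C, f ω ∂P = P.real (C ∩ E) := by
      rw [hfdef, setIntegral_indicator hE]
      simp
    rw [h3] at h2
    have h4 : P.real C ≤ 1 := measureReal_le_one
    nlinarith
  have h5 : P.real (C ∩ E) = 0 :=
    le_antisymm (le_of_forall_pos_le_add fun ε hε => by simpa using h1 ε hε) measureReal_nonneg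
  have h6 : P (C ∩ E) = 0 := (measureReal_eq_zero_iff).1 h5
  filter_upwards [hpt, measure_eq_zero_iff_ae_notMem.1 h6] with ω h7 h8 h9
  refine ⟨_, ?_, h7⟩
  by_contra! h10
  exact h8 ⟨h10, h9⟩


end VisitFreq

namespace VisitFreq

lemma count_lower {Ω : Type*} (T : Ω → Ω) (E : Set Ω) (ω : Ω) (n K K' : ℕ) (hK : K' ≤ K) :
    birkhoffSum T (E.indicator (1 : Ω → ℝ)) (n + 1) ω
      - birkhoffSum T (E.indicator (1 : Ω → ℝ)) (n + 1 - K') ω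
    ≤ (Nat.card {n' : ℕ | n' < K ∧ T^[n - n'] ω ∈ E} : ℝ) := by
  classical
  have h1 : birkhoffSum T (E.indicator (1 : Ω → ℝ)) (n + 1) ω
      - birkhoffSum T (E.indicator (1 : Ω → ℝ)) (n + 1 - K') ω
      = (((Finset.Ico (n + 1 - K') (n + 1)).filter fun j => T^[j] ω ∈ E).card : ℝ) := by
    unfold birkhoffSum
    rw [← Finset.sum_Ico_eq_sub _ (Nat.sub_le _ _), Finset.card_filter]
    push_cast
    refine Finset.sum_congr rfl fun j _ => ?_
    simp [Set.indicator_apply]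
  rw [h1]
  have hinj : Set.InjOn (fun j => n - j)
      ((Finset.Ico (n + 1 - K') (n + 1)).filter fun j => T^[j] ω ∈ E : Finset ℕ) := by
    intro a ha b hb hab
    simp only [Finset.coe_filter, Finset.mem_Ico, Set.mem_ofPred_eq] at ha hb hab
    omega
  rw [← Finset.card_image_of_injOn hinj, ← Set.ncard_coe_finset]
  rw [Nat.card_coe_set_eq]
  refine Nat.cast_le.2 ?_
  have hfin : {n' : ℕ | n' < K ∧ T^[n - n'] ω ∈ E}.Finite :=
    (Set.finite_lt_nat K).subset (fun n' (h : n' < K ∧ T^[n - n'] ω ∈ E) => h.1)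
  refine Set.ncard_le_ncard ?_ hfin
  intro k hk
  simp only [Finset.coe_image, Finset.coe_filter, Finset.mem_Ico, Set.mem_image,
    Set.mem_ofPred_eq] at hk
  obtain ⟨j, ⟨⟨hj1, hj2⟩, hj3⟩, rfl⟩ := hk
  refine ⟨by omega, ?_⟩
  have : n - (n - j) = j := by omega
  rwa [this]

lemma count_upper {Ω : Type*} (T : Ω → Ω) (E : Set Ω) (ω : Ω) (n K : ℕ) :
    Nat.card {n' : ℕ | n' < K ∧ T^[n - n'] ω ∈ E} ≤ K := by
  rw [Nat.card_coe_set_eq]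
  have h : ({n' : ℕ | n' < K ∧ T^[n - n'] ω ∈ E}) ⊆ ((Finset.range K : Finset ℕ) : Set ℕ) := by
    intro k hk
    simpa using hk.1
  have := Set.ncard_le_ncard h (Finset.finite_toSet _)
  rwa [Set.ncard_coe_finset, Finset.card_range] at this

lemma lower_tendsto (S : ℕ → ℝ) (l : ℝ) (hS : Tendsto (fun n : ℕ => (n : ℝ)⁻¹ * S n) atTop (𝓝 l))
    (η : ℝ) (h0 : 0 < η) (h1 : η < 1) :
    Tendsto (fun n : ℕ => (S (n + 1) - S (n + 1 - ⌈η * (n : ℝ)⌉₊)) / n) atTop (𝓝 (l * η)) := by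
  have hceil : Tendsto (fun n : ℕ => (⌈η * (n : ℝ)⌉₊ : ℝ) / n) atTop (𝓝 η) :=
    (tendsto_nat_ceil_mul_div_atTop h0.le).comp tendsto_natCast_atTop_atTop
  have hinv : Tendsto (fun n : ℕ => ((n : ℝ))⁻¹) atTop (𝓝 0) := tendsto_inv_atTop_nhds_zero_nat
  have hle : ∀ n : ℕ, ⌈η * (n : ℝ)⌉₊ ≤ n := by
    intro n
    rw [Nat.ceil_le]
    have : (0 : ℝ) ≤ n := by positivity
    nlinarith
  have hcast : ∀ n : ℕ, ((n + 1 - ⌈η * (n : ℝ)⌉₊ : ℕ) : ℝ) = n + 1 - (⌈η * (n : ℝ)⌉₊ : ℝ) := by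
    intro n
    rw [Nat.cast_sub ((hle n).trans (Nat.le_succ n))]
    push_cast
    ring
  have hm : Tendsto (fun n : ℕ => n + 1 - ⌈η * (n : ℝ)⌉₊) atTop atTop := by
    rw [← tendsto_natCast_atTop_iff (R := ℝ)]
    have h2 : Tendsto (fun n : ℕ => (1 - η) * (n : ℝ)) atTop atTop :=
      tendsto_natCast_atTop_atTop.const_mul_atTop (by linarith)
    refine tendsto_atTop_mono (fun n => ?_) h2
    show _ ≤ ((n + 1 - ⌈η * (n : ℝ)⌉₊ : ℕ) : ℝ)
    rw [hcast]
    have := Nat.ceil_lt_add_one (show 0 ≤ η * (n : ℝ) by positivity)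
    linarith
  have hA := hS.comp (tendsto_add_atTop_nat 1)
  have hB := hS.comp hm
  have hq1 : Tendsto (fun n : ℕ => 1 + ((n : ℝ))⁻¹) atTop (𝓝 (1 + 0)) :=
    tendsto_const_nhds.add hinv
  have hq2 : Tendsto (fun n : ℕ => 1 + ((n : ℝ))⁻¹ - (⌈η * (n : ℝ)⌉₊ : ℝ) / n) atTop
      (𝓝 (1 + 0 - η)) := hq1.sub hceil
  have hfin := (hA.mul hq1).sub (hB.mul hq2)
  have hval : l * (1 + 0) - l * (1 + 0 - η) = l * η := by ring
  rw [hval] at hfin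
  refine hfin.congr' ?_
  filter_upwards [eventually_ne_atTop 0] with n hn
  have hn' : (n : ℝ) ≠ 0 := by exact_mod_cast hn
  have hp : ((n + 1 - ⌈η * (n : ℝ)⌉₊ : ℕ) : ℝ) ≠ 0 := by
    have := hle n
    have h3 : n + 1 - ⌈η * (n : ℝ)⌉₊ ≠ 0 := by omega
    exact_mod_cast h3
  have e2 : 1 + ((n : ℝ))⁻¹ - (⌈η * (n : ℝ)⌉₊ : ℝ) / n
      = ((n + 1 - ⌈η * (n : ℝ)⌉₊ : ℕ) : ℝ) / n := by
    rw [hcast]; field_simp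
  have e1 : 1 + ((n : ℝ))⁻¹ = ((n + 1 : ℕ) : ℝ) / n := by
    push_cast; field_simp
  have hp1 : ((n + 1 : ℕ) : ℝ) ≠ 0 := by positivity
  rw [e2, e1]
  simp only [Function.comp_apply]
  generalize ((n + 1 - ⌈η * (n : ℝ)⌉₊ : ℕ) : ℝ) = q at hp ⊢
  generalize ((n + 1 : ℕ) : ℝ) = r at hp1 ⊢
  field_simp

lemma action_pow {Γ : Type*} [Group Γ] {Ω : Type*} (θ : Γ → Ω → Ω) (h1 : θ 1 = id)
    (hm : ∀ x y : Γ, θ (x * y) = θ x ∘ θ y) (x : Γ) (n : ℕ) : θ (x ^ n) = (θ x)^[n] := by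
  induction n with
  | zero => simp [h1]
  | succ n ih => rw [pow_succ, hm, ih, Function.iterate_succ]

lemma liminf_pos {Ω : Type*} (T : Ω → Ω) (E : Set Ω) (ω : Ω) (ξ : ℝ) (hξ : 0 < ξ) (l : ℝ)
    (hl : 0 < l)
    (h : Tendsto (fun n => birkhoffAverage ℝ T (E.indicator 1) n ω) atTop (𝓝 l)) :
    0 < liminf (fun n : ℕ =>
      (Nat.card {n' : ℕ | n' < ⌈ξ * (n : ℝ)⌉₊ ∧ T^[n - n'] ω ∈ E} : ℝ) / (ξ * n)) atTop := by
  set η : ℝ := min ξ (1 / 2) with hη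
  have hη0 : 0 < η := lt_min hξ (by norm_num)
  have hη1 : η < 1 := lt_of_le_of_lt (min_le_right _ _) (by norm_num)
  have ht := lower_tendsto (fun n => birkhoffSum T (E.indicator (1 : Ω → ℝ)) n ω) l
    h η hη0 hη1
  have ht' := ht.div_const ξ
  have hpos : 0 < l * η / ξ := by positivity
  refine lt_of_lt_of_le (half_pos hpos) (le_liminf_of_le ?_ ?_)
  · refine IsBoundedUnder.isCoboundedUnder_ge (isBoundedUnder_of ⟨1 + 1 / ξ, fun n => ?_⟩)
    rcases Nat.eq_zero_or_pos n with rfl | hn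
    · simp; positivity
    · have hn' : (1 : ℝ) ≤ n := by exact_mod_cast hn
      have h1 : (Nat.card {n' : ℕ | n' < ⌈ξ * (n : ℝ)⌉₊ ∧ T^[n - n'] ω ∈ E} : ℝ)
          ≤ (⌈ξ * (n : ℝ)⌉₊ : ℝ) := by
        exact_mod_cast count_upper T E ω n _
      have h2 := Nat.ceil_lt_add_one (show 0 ≤ ξ * (n : ℝ) by positivity)
      rw [div_le_iff₀ (by positivity)]
      have h3 : (1 + 1 / ξ) * (ξ * n) = ξ * n + n := by field_simp
      rw [h3]
      linarith
  · filter_upwards [ht'.eventually (lt_mem_nhds (half_lt_self hpos))] with n hn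
    refine hn.le.trans ?_
    rw [div_div, mul_comm (n : ℝ) ξ]
    have hK : ⌈η * (n : ℝ)⌉₊ ≤ ⌈ξ * (n : ℝ)⌉₊ :=
      Nat.ceil_mono (mul_le_mul_of_nonneg_right (min_le_left _ _) (Nat.cast_nonneg n))
    exact div_le_div_of_nonneg_right (count_lower T E ω n _ _ hK) (by positivity)

end VisitFreq

/-- visit-frequency estimates.  With
`N^ξ_{x,n}(E,ω) = #{n' < ⌈ξn⌉ : θ_{x^{n-n'}}(ω) ∈ E}`,
`Ξ* = {ω : liminf N^ξ_{x,n}(E,ω)/(ξn) > 0}` and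
`Ξ*_m = {ω : ∀ n ≥ m, N^ξ_{x,n}(E,ω) > 0}`, one has `P(Ξ*) ≥ P(E)` and, for every
`ε ∈ (0,1)`, `P(Ξ*_m) > P(Ξ*) - ε` for all large enough `m`. -/
theorem visit_frequency {Γ : Type*} [Group Γ] [Group.FG Γ]
    {Ω : Type*} [MeasurableSpace Ω] (P : Measure Ω) [IsProbabilityMeasure P]
    (θ : Γ → Ω → Ω) (hθ : IsPMPAction θ P) (herg : IsErgodicAction θ P)
    (x : Γ) (ξ : ℝ) (hξ : 0 < ξ) (E : Set Ω) (hE : MeasurableSet E)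
    (N : ℕ → Ω → ℕ)
    (hN : ∀ n ω, N n ω =
      Nat.card {n' : ℕ | n' < ⌈ξ * (n : ℝ)⌉₊ ∧ θ (x ^ (n - n')) ω ∈ E})
    (Ξstar : Set Ω)
    (hΞ : Ξstar = {ω | 0 < Filter.liminf (fun n : ℕ => (N n ω : ℝ) / (ξ * n)) atTop})
    (Ξm : ℕ → Set Ω) (hΞm : ∀ m, Ξm m = {ω | ∀ n ≥ m, 0 < N n ω}) :
    P E ≤ P Ξstar ∧
    ∀ ε : ℝ, 0 < ε → ε < 1 → ∃ m₀ : ℕ, ∀ m : ℕ, m₀ < m →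
      (P Ξstar).toReal - ε < (P (Ξm m)).toReal := by

  obtain ⟨h1, hmul, hmp⟩ := hθ
  have hN' : ∀ n ω, N n ω =
      Nat.card {n' : ℕ | n' < ⌈ξ * (n : ℝ)⌉₊ ∧ (θ x)^[n - n'] ω ∈ E} := by
    intro n ω
    rw [hN]
    simp only [VisitFreq.action_pow θ h1 hmul]
  constructor
  · refine measure_mono_ae ?_
    filter_upwards [VisitFreq.pos_on (hmp x) hE] with ω hω hωE
    obtain ⟨l, hl, ht⟩ := hω hωE
    have := VisitFreq.liminf_pos (θ x) E ω ξ hξ l hl ht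
    rw [hΞ]
    show 0 < Filter.liminf (fun n : ℕ => (N n ω : ℝ) / (ξ * n)) atTop
    simpa only [hN'] using this
  · intro ε hε _
    have hmono : Monotone Ξm := by
      intro a b hab ω hω
      rw [hΞm] at hω ⊢
      exact fun n hn => hω n (hab.trans hn)
    have hsub : Ξstar ⊆ ⋃ m, Ξm m := by
      intro ω hω
      rw [hΞ] at hω
      change 0 < Filter.liminf (fun n : ℕ => (N n ω : ℝ) / (ξ * n)) atTop at hω
      have hev := eventually_lt_of_lt_liminf hω
        (isBoundedUnder_of ⟨0, fun n => by positivity⟩)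
      obtain ⟨m, hm⟩ := eventually_atTop.1 hev
      refine Set.mem_iUnion.2 ⟨m, ?_⟩
      rw [hΞm]
      intro n hn
      have := hm n hn
      by_contra h0
      have h0' : N n ω = 0 := by omega
      simp [h0'] at this
    have hlim : Tendsto (fun m => (P (Ξm m)).toReal) atTop (nhds (P (⋃ m, Ξm m)).toReal) :=
      (ENNReal.tendsto_toReal (measure_ne_top P _)).comp (tendsto_measure_iUnion_atTop hmono)
    have hle : (P Ξstar).toReal ≤ (P (⋃ m, Ξm m)).toReal :=
      ENNReal.toReal_mono (measure_ne_top P _) (measure_mono hsub)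
    obtain ⟨m₀, hm₀⟩ := eventually_atTop.1 (hlim.eventually (lt_mem_nhds
      (show (P Ξstar).toReal - ε < (P (⋃ m, Ξm m)).toReal by linarith)))
    exact ⟨m₀, fun m hm => hm₀ m hm.le⟩
end

section
/- Let Γ be a countable group, N ⊴ Γ a normal subgroup of finite index κ = [Γ : N], and θ an ergodic measure-preserving action of Γ on a probability space (Ω,F,P). Then there exists a finite family 𝔅 ⊆ F of measurable sets with |𝔅| ≤ κ such that: every B ∈ 𝔅 satisfies P(B) ≥ 1/κ and θ_x⁻¹(B) = B for all x ∈ N; the restriction of θ to N is an ergodic measure-preserving action on (B, F ∩ B, P(· | B)) for every B ∈ 𝔅; and P(⋃_{B ∈ 𝔅} B) = 1. -/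
open MeasureTheory Filter

theorem aux_orbit {Γ : Type*} [Group Γ] (N : Subgroup Γ) [N.Normal]
    {Ω : Type*} [MeasurableSpace Ω] (P : Measure Ω)
    (θ : Γ → Ω → Ω) (hθ : IsPMPAction θ P) (B : Set Ω) (hB : ∀ x ∈ N, θ x ⁻¹' B = B) (g : Γ) :
    θ ((g : Γ ⧸ N).out) ⁻¹' B = θ g ⁻¹' B := by
  have h1 : ((g : Γ ⧸ N).out)⁻¹ * g ∈ N := by
    rw [← QuotientGroup.eq]; simp
  have h2 : g * ((g : Γ ⧸ N).out)⁻¹ ∈ N := Subgroup.Normal.mem_comm inferInstance h1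
  have h3 : θ g = θ (g * ((g : Γ ⧸ N).out)⁻¹) ∘ θ ((g : Γ ⧸ N).out) := by
    rw [← hθ.2.1]; simp
  rw [h3, Set.preimage_comp, hB _ h2]

theorem aux_inv {Γ : Type*} [Group Γ] (N : Subgroup Γ) [N.Normal]
    {Ω : Type*} [MeasurableSpace Ω] (P : Measure Ω)
    (θ : Γ → Ω → Ω) (hθ : IsPMPAction θ P) (B : Set Ω) (hB : ∀ x ∈ N, θ x ⁻¹' B = B) (g : Γ) :
    ∀ x ∈ N, θ x ⁻¹' (θ g ⁻¹' B) = θ g ⁻¹' B := by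
  intro x hx
  have h2 : g * x * g⁻¹ ∈ N := Subgroup.Normal.conj_mem inferInstance x hx g
  rw [← Set.preimage_comp, ← hθ.2.1]
  have : g * x = (g * x * g⁻¹) * g := by simp
  rw [this, hθ.2.1, Set.preimage_comp, hB _ h2]

theorem aux_cover {Γ : Type*} [Group Γ] [Countable Γ] (N : Subgroup Γ)
    {Ω : Type*} [MeasurableSpace Ω] (P : Measure Ω)
    (θ : Γ → Ω → Ω) (hθ : IsPMPAction θ P) (herg : IsErgodicAction θ P)
    (B : Set Ω) (hm : MeasurableSet B) (h0 : P B ≠ 0) :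
    P (⋃ g, θ g ⁻¹' B) = 1 := by
  refine (herg _ (MeasurableSet.iUnion fun g => (hθ.2.2 g).measurable hm) ?_).resolve_left ?_
  · intro x
    ext ω
    simp only [Set.mem_preimage, Set.mem_iUnion]
    constructor
    · rintro ⟨g, hg⟩
      exact ⟨g * x, by rw [hθ.2.1]; exact hg⟩
    · rintro ⟨g, hg⟩
      refine ⟨g * x⁻¹, ?_⟩
      have : θ (g * x⁻¹) (θ x ω) = θ g ω := by
        rw [← Function.comp_apply (f := θ (g * x⁻¹)), ← hθ.2.1]; simp
      rwa [this]
  · intro h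
    apply h0
    refine measure_mono_null (fun ω hω => Set.mem_iUnion.2 ⟨1, ?_⟩) h
    rw [hθ.1]; exact hω

theorem aux_lower {Γ : Type*} [Group Γ] [Countable Γ] (N : Subgroup Γ) [N.Normal]
    (κ : ℕ) (hκpos : 0 < κ) (hκ : N.index = κ)
    {Ω : Type*} [MeasurableSpace Ω] (P : Measure Ω)
    (θ : Γ → Ω → Ω) (hθ : IsPMPAction θ P) (herg : IsErgodicAction θ P)
    (B : Set Ω) (hm : MeasurableSet B) (hB : ∀ x ∈ N, θ x ⁻¹' B = B) (h0 : P B ≠ 0) :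
    (κ : ENNReal)⁻¹ ≤ P B := by
  have : N.FiniteIndex := ⟨by omega⟩
  have : Fintype (Γ ⧸ N) := Fintype.ofFinite _
  have hc : Fintype.card (Γ ⧸ N) = κ := by
    rw [← hκ, Subgroup.index, Nat.card_eq_fintype_card]
  have h1 := aux_cover N P θ hθ herg B hm h0
  have h2 : (⋃ g, θ g ⁻¹' B) ⊆ ⋃ q : Γ ⧸ N, θ q.out ⁻¹' B := by
    refine Set.iUnion_subset fun g => ?_
    rw [← aux_orbit N P θ hθ B hB g]
    exact Set.subset_iUnion (fun q : Γ ⧸ N => θ q.out ⁻¹' B) (g : Γ ⧸ N)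
  have h3 : (1 : ENNReal) ≤ κ * P B := by
    calc (1 : ENNReal) ≤ P (⋃ q : Γ ⧸ N, θ q.out ⁻¹' B) := h1 ▸ measure_mono h2
      _ ≤ ∑ q : Γ ⧸ N, P (θ q.out ⁻¹' B) := measure_iUnion_fintype_le _ _
      _ = κ * P B := by
        simp [fun q : Γ ⧸ N => (hθ.2.2 q.out).measure_preimage hm.nullMeasurableSet, hc]
  rw [← one_div]
  exact ENNReal.div_le_of_le_mul' h3

theorem aux_atom {Γ : Type*} [Group Γ] [Countable Γ] (N : Subgroup Γ) [N.Normal]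
    (κ : ℕ) (hκpos : 0 < κ) (hκ : N.index = κ)
    {Ω : Type*} [MeasurableSpace Ω] (P : Measure Ω) [IsProbabilityMeasure P]
    (θ : Γ → Ω → Ω) (hθ : IsPMPAction θ P) (herg : IsErgodicAction θ P) (n : ℕ) :
    ∀ B : Set Ω, MeasurableSet B → (∀ x ∈ N, θ x ⁻¹' B = B) → P B ≠ 0 →
      P B < n * (κ : ENNReal)⁻¹ →
      ∃ A : Set Ω, MeasurableSet A ∧ (∀ x ∈ N, θ x ⁻¹' A = A) ∧ P A ≠ 0 ∧
        ∀ E : Set Ω, MeasurableSet E → E ⊆ A → (∀ x ∈ N, θ x ⁻¹' E = E) →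
          P E = 0 ∨ P E = P A := by
  induction n with
  | zero => intro B _ _ _ h; simp at h
  | succ n ih =>
    intro B hm hB h0 hlt
    by_cases hall : ∀ E : Set Ω, MeasurableSet E → E ⊆ B → (∀ x ∈ N, θ x ⁻¹' E = E) →
          P E = 0 ∨ P E = P B
    · exact ⟨B, hm, hB, h0, hall⟩
    · push Not at hall
      obtain ⟨E, hEm, hEB, hE, hE0, hE1⟩ := hall
      refine ih E hEm hE hE0 ?_
      have hsum : P E + P (B \ E) = P B := by
        rw [measure_add_diff hEm.nullMeasurableSet, Set.union_eq_self_of_subset_left hEB]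
      have hd : (κ : ENNReal)⁻¹ ≤ P (B \ E) := by
        refine aux_lower N κ hκpos hκ P θ hθ herg _ (hm.diff hEm) ?_ ?_
        · intro x hx; rw [Set.preimage_diff, hB x hx, hE x hx]
        · intro h; rw [h, add_zero] at hsum; exact hE1 hsum
      have hfin : (κ : ENNReal)⁻¹ ≠ ⊤ := by simpa using hκpos.ne'
      have : P E + (κ : ENNReal)⁻¹ < n * (κ : ENNReal)⁻¹ + (κ : ENNReal)⁻¹ := by
        calc P E + (κ : ENNReal)⁻¹ ≤ P E + P (B \ E) := by gcongr
          _ = P B := hsum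
          _ < _ := by
            refine hlt.trans_eq ?_
            push_cast; ring
      exact lt_of_add_lt_add_right this

/-- an ergodic action of `Γ` restricted to a finite-index normal subgroup `N`
decomposes the space into at most `κ = [Γ:N]` invariant pieces of measure `≥ 1/κ`, on each
of which the restricted `N`-action is ergodic (with respect to the conditional measure),
and which together cover the space. -/
theorem ergodic_decomposition_finite_index {Γ : Type*} [Group Γ] [Countable Γ]
    (N : Subgroup Γ) [N.Normal] (κ : ℕ) (hκpos : 0 < κ) (hκ : N.index = κ)
    {Ω : Type*} [MeasurableSpace Ω] (P : Measure Ω) [IsProbabilityMeasure P]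
    (θ : Γ → Ω → Ω) (hθ : IsPMPAction θ P) (herg : IsErgodicAction θ P) :
    ∃ 𝔅 : Finset (Set Ω), 𝔅.card ≤ κ ∧
      (∀ B ∈ 𝔅, MeasurableSet B ∧ ((κ : ENNReal))⁻¹ ≤ P B ∧
        (∀ x ∈ N, θ x ⁻¹' B = B) ∧
        (∀ E : Set Ω, MeasurableSet E → E ⊆ B → (∀ x ∈ N, θ x ⁻¹' E = E) →
          P (E ∩ B) / P B = 0 ∨ P (E ∩ B) / P B = 1)) ∧
      P (⋃ B ∈ 𝔅, B) = 1 := by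
  classical
  obtain ⟨A, hAm, hA, hA0, hAe⟩ := aux_atom N κ hκpos hκ P θ hθ herg (κ + 1) Set.univ
    MeasurableSet.univ (fun _ _ => rfl) (by simp) (by
      have hfin : (κ : ENNReal)⁻¹ ≠ ⊤ := by simpa using hκpos.ne'
      have h1 : (κ : ENNReal) * (κ : ENNReal)⁻¹ = 1 :=
        ENNReal.mul_inv_cancel (by simpa using hκpos.ne') (by simp)
      push_cast
      rw [add_mul, h1, measure_univ, one_mul]
      exact ENNReal.lt_add_right (by simp) (by simp))
  have : N.FiniteIndex := ⟨by omega⟩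
  have : Fintype (Γ ⧸ N) := Fintype.ofFinite _
  have hc : Fintype.card (Γ ⧸ N) = κ := by
    rw [← hκ, Subgroup.index, Nat.card_eq_fintype_card]
  have hmp : ∀ (g : Γ) {E : Set Ω}, MeasurableSet E → P (θ g ⁻¹' E) = P E :=
    fun g E hE => (hθ.2.2 g).measure_preimage hE.nullMeasurableSet
  have hlow := aux_lower N κ hκpos hκ P θ hθ herg A hAm hA hA0
  refine ⟨Finset.univ.image fun q : Γ ⧸ N => θ q.out ⁻¹' A, ?_, ?_, ?_⟩
  · exact Finset.card_image_le.trans (by simp [hc])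
  · intro B hB
    simp only [Finset.mem_image, Finset.mem_univ, true_and] at hB
    obtain ⟨q, rfl⟩ := hB
    generalize q.out = g
    refine ⟨(hθ.2.2 g).measurable hAm, by rwa [hmp g hAm], aux_inv N P θ hθ A hA g, ?_⟩
    intro E hEm hEA hE
    rw [Set.inter_eq_self_of_subset_left hEA, hmp g hAm]
    have h := hAe (θ g⁻¹ ⁻¹' E) ((hθ.2.2 _).measurable hEm) ?_ (aux_inv N P θ hθ E hE g⁻¹)
    · rw [hmp _ hEm] at h
      rcases h with h | h
      · left; simp [h]
      · right; rw [h]; exact ENNReal.div_self hA0 (measure_ne_top _ _)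
    · refine (Set.preimage_mono hEA).trans ?_
      rw [← Set.preimage_comp, ← hθ.2.1]
      simp [hθ.1]
  · have h1 := aux_cover N P θ hθ herg A hAm hA0
    refine le_antisymm prob_le_one (h1 ▸ measure_mono ?_)
    refine Set.iUnion_subset fun g => ?_
    rw [← aux_orbit N P θ hθ A hA g]
    exact Set.subset_biUnion_of_mem (u := fun s : Set Ω => s)
      (Finset.mem_coe.2 (Finset.mem_image_of_mem _ (Finset.mem_univ (g : Γ ⧸ N))))
end
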